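/- arXiv:1711.08554 — 12 statements merged into one kernel-verified Lean document; each statement's English description precedes it below -/
import Mathlib

section
/- Let F be a countable field and let R be the polynomial ring over F in countably infinitely many indeterminates (i.e., the multivariate polynomial ring MvPolynomial ℕ F). Then there exists a chain of prime ideals of R of cardinality 2^ℵ₀, and every chain of prime ideals of R has cardinality at most 2^ℵ₀; hence R has strong cardinal Krull dimension 2^ℵ₀. -/
universe u
open Cardinal

noncomputable def chainLen {X : Type u} (C : Set X) : Cardinal.{u} := by
  classical exact if h : C.Finite then ((h.toFinset.card - 1 : ℕ) : Cardinal.{u}) else #C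

def IsPrimeIdealChain {R : Type u} [Ring R] (C : Set (Ideal R)) : Prop :=
  (∀ P ∈ C, P.IsPrime) ∧ IsChain (· ≤ ·) C

noncomputable def cKrullDim (R : Type u) [Ring R] : Cardinal.{u} :=
  ⨆ C : {C : Set (Ideal R) // C.Nonempty ∧ IsPrimeIdealChain C}, chainLen C.1

def HasStrongCDim (R : Type u) [Ring R] (lam : Cardinal.{u}) : Prop :=
  cKrullDim R = lam ∧
    ∃ C : Set (Ideal R), C.Nonempty ∧ IsPrimeIdealChain C ∧ chainLen C = lam

/-- The substitution sending to `0` the variables `X n` with `q n < r` and fixing the others. -/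
noncomputable def killBelow (F : Type) [Field F] (q : ℕ → ℚ) (r : ℝ) :
    MvPolynomial ℕ F →ₐ[F] MvPolynomial ℕ F := by
  classical exact MvPolynomial.aeval fun n => if (q n : ℝ) < r then 0 else MvPolynomial.X n

theorem killBelow_X (F : Type) [Field F] (q : ℕ → ℚ) (r : ℝ) (n : ℕ) [Decidable ((q n : ℝ) < r)] :
    killBelow F q r (MvPolynomial.X n) = if (q n : ℝ) < r then 0 else MvPolynomial.X n := by
  classical
  simp [killBelow]

theorem killBelow_comp (F : Type) [Field F] (q : ℕ → ℚ) {r s : ℝ} (h : r ≤ s) :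
    (killBelow F q s).comp (killBelow F q r) = killBelow F q s := by
  classical
  refine MvPolynomial.algHom_ext fun n => ?_
  rw [AlgHom.comp_apply, killBelow_X F q r]
  split_ifs with hr
  · simp [killBelow_X, hr.trans_le h]
  · rfl

theorem ker_killBelow_mono (F : Type) [Field F] (q : ℕ → ℚ) :
    Monotone fun r => RingHom.ker (killBelow F q r) := by
  intro r s h p hp
  rw [RingHom.mem_ker] at hp ⊢
  rw [← killBelow_comp F q h, AlgHom.comp_apply, hp, map_zero]

theorem X_mem_ker_killBelow (F : Type) [Field F] (q : ℕ → ℚ) (r : ℝ) (n : ℕ) :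
    MvPolynomial.X n ∈ RingHom.ker (killBelow F q r) ↔ (q n : ℝ) < r := by
  classical
  simp [RingHom.mem_ker, killBelow_X, MvPolynomial.X_ne_zero]

theorem ker_killBelow_injective (F : Type) [Field F] {q : ℕ → ℚ} (hq : q.Surjective) :
    Function.Injective fun r => RingHom.ker (killBelow F q r) := by
  have key : ∀ r s : ℝ, r < s →
      RingHom.ker (killBelow F q r) ≠ RingHom.ker (killBelow F q s) := by
    intro r s hrs heq
    obtain ⟨x, hrx, hxs⟩ := exists_rat_btwn hrs
    obtain ⟨n, rfl⟩ := hq x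
    have := (X_mem_ker_killBelow F q s n).2 hxs
    rw [← heq, X_mem_ker_killBelow] at this
    exact lt_asymm this hrx
  intro r s h
  rcases lt_trichotomy r s with hrs | hrs | hrs
  · exact (key r s hrs h).elim
  · exact hrs
  · exact (key s r hrs h.symm).elim

theorem exists_isPrimeIdealChain_mk_eq (F : Type) [Field F] :
    ∃ C : Set (Ideal (MvPolynomial ℕ F)),
      IsPrimeIdealChain C ∧ #C = 2 ^ (ℵ₀ : Cardinal) := by
  obtain ⟨q, hq⟩ := exists_surjective_nat ℚ
  refine ⟨Set.range fun r => RingHom.ker (killBelow F q r), ⟨?_, ?_⟩, ?_⟩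
  · rintro _ ⟨r, rfl⟩
    exact RingHom.ker_isPrime _
  · exact (ker_killBelow_mono F q).isChain_range
  · rw [mk_range_eq _ (ker_killBelow_injective F hq), mk_real, two_power_aleph0]

theorem mk_set_ideal_le (R : Type u) [Ring R] [Countable R] (C : Set (Ideal R)) :
    #C ≤ 2 ^ (ℵ₀ : Cardinal) :=
  calc #C ≤ #(Ideal R) := mk_set_le C
    _ ≤ #(Set R) := mk_le_of_injective SetLike.coe_injective
    _ = 2 ^ #R := mk_set
    _ ≤ 2 ^ (ℵ₀ : Cardinal) := power_le_power_left two_ne_zero (mk_le_aleph0_iff.2 ‹_›)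

theorem chainLen_le_mk {X : Type u} (C : Set X) : chainLen C ≤ #C := by
  classical
  unfold chainLen
  split_ifs with h
  · rw [← Set.cast_ncard h, Set.ncard_eq_toFinset_card C h]
    exact_mod_cast Nat.sub_le _ _
  · exact le_rfl

theorem hasStrongCDim_of_mk_eq {R : Type u} [Ring R] {c : Cardinal.{u}} (hc : ℵ₀ ≤ c)
    (hle : ∀ C : Set (Ideal R), IsPrimeIdealChain C → #C ≤ c)
    {C : Set (Ideal R)} (hC : IsPrimeIdealChain C) (hCc : #C = c) : HasStrongCDim R c := by
  have hinf : Infinite C := infinite_iff.2 (hCc ▸ hc)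
  have hne : C.Nonempty := Set.nonempty_coe_sort.1 inferInstance
  have hlen : chainLen C = c := by
    rw [chainLen, dif_neg (Set.infinite_coe_iff.1 hinf), hCc]
  have hub : ∀ D : {D : Set (Ideal R) // D.Nonempty ∧ IsPrimeIdealChain D},
      chainLen D.1 ≤ c := fun D => (chainLen_le_mk _).trans (hle _ D.2.2)
  refine ⟨le_antisymm (ciSup_le' hub) ?_, C, hne, hC, hlen⟩
  exact hlen.ge.trans
    (le_ciSup (f := fun D : {D : Set (Ideal R) // D.Nonempty ∧ IsPrimeIdealChain D} =>
      chainLen D.1) ⟨c, Set.forall_mem_range.2 hub⟩ ⟨C, hne, hC⟩)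

theorem countable_mvPolynomial_nat (F : Type) [Field F] [Countable F] :
    Countable (MvPolynomial ℕ F) := by
  rw [← mk_le_aleph0_iff]
  exact MvPolynomial.cardinalMk_le_max.trans (by simp)

/-- For a countable field `F`, the polynomial ring `MvPolynomial ℕ F` in
countably many indeterminates has a chain of prime ideals of cardinality `2 ^ ℵ₀`, every
chain of prime ideals has cardinality at most `2 ^ ℵ₀`, and hence it has strong cardinal
Krull dimension `2 ^ ℵ₀`. -/
theorem stmt0 (F : Type) [Field F] [Countable F] :
    (∃ C : Set (Ideal (MvPolynomial ℕ F)),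
        IsPrimeIdealChain C ∧ #C = 2 ^ (ℵ₀ : Cardinal)) ∧
    (∀ C : Set (Ideal (MvPolynomial ℕ F)),
        IsPrimeIdealChain C → #C ≤ 2 ^ (ℵ₀ : Cardinal)) ∧
    HasStrongCDim (MvPolynomial ℕ F) (2 ^ (ℵ₀ : Cardinal)) := by
  have := countable_mvPolynomial_nat F
  have hle : ∀ C : Set (Ideal (MvPolynomial ℕ F)),
      IsPrimeIdealChain C → #C ≤ 2 ^ (ℵ₀ : Cardinal) := fun C _ => mk_set_ideal_le _ C
  obtain ⟨C, hC, hCc⟩ := exists_isPrimeIdealChain_mk_eq F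
  exact ⟨⟨C, hC, hCc⟩, hle, hasStrongCDim_of_mk_eq (cantor ℵ₀).le hle hC hCc⟩
end

section
/- Let κ and λ be cardinals with κ ≥ λ. Then there exists a commutative unital ring R of cardinality κ with cardinal Krull dimension λ if and only if κ ≥ 2 and (if κ is finite then λ = 0). Moreover, when these conditions hold, such a ring R can be chosen having strong cardinal Krull dimension λ. -/
universe u
open Cardinal

section ChainLength

variable {X : Type u} {C : Set X} {c : Cardinal.{u}}

lemma chainLen_of_finite (h : C.Finite) : chainLen C = ((C.ncard - 1 : ℕ) : Cardinal.{u}) := by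
  rw [chainLen, dif_pos h, Set.ncard_eq_toFinset_card C h]

lemma chainLen_of_infinite (h : C.Infinite) : chainLen C = #C :=
  dif_neg h

lemma chainLen_le_of_mk_le_add_one (h : #C ≤ c + 1) : chainLen C ≤ c := by
  rcases C.finite_or_infinite with hC | hC
  · rw [chainLen_of_finite hC]
    rcases lt_or_ge c ℵ₀ with hc | hc
    · obtain ⟨m, rfl⟩ := Cardinal.lt_aleph0.1 hc
      rw [← Set.cast_ncard hC] at h
      have h' : C.ncard ≤ m + 1 := by exact_mod_cast h
      exact_mod_cast (by omega : C.ncard - 1 ≤ m)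
    · exact Cardinal.natCast_lt_aleph0.le.trans hc
  · rw [chainLen_of_infinite hC]
    have h₀ : ℵ₀ ≤ #C := Cardinal.infinite_iff.1 hC.to_subtype
    rcases lt_or_ge c ℵ₀ with hc | hc
    · exact absurd (h₀.trans h) (not_le.2 (Cardinal.add_lt_aleph0 hc Cardinal.one_lt_aleph0))
    · rwa [Cardinal.add_one_eq hc] at h

lemma chainLen_eq_of_mk_eq_add_one (h : #C = c + 1) : chainLen C = c := by
  refine (chainLen_le_of_mk_le_add_one h.le).antisymm ?_
  rcases C.finite_or_infinite with hC | hC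
  · rw [chainLen_of_finite hC]
    rw [← Set.cast_ncard hC] at h
    have hc : c < ℵ₀ := (self_le_add_right c 1).trans_lt (h ▸ Cardinal.natCast_lt_aleph0)
    obtain ⟨m, rfl⟩ := Cardinal.lt_aleph0.1 hc
    have h' : C.ncard = m + 1 := by exact_mod_cast h
    exact_mod_cast (by omega : m ≤ C.ncard - 1)
  · rw [chainLen_of_infinite hC, h]
    exact self_le_add_right c 1

end ChainLength

lemma chainLen_le_cKrullDim {R : Type u} [Ring R] {C : Set (Ideal R)} (hne : C.Nonempty)
    (hC : IsPrimeIdealChain C) : chainLen C ≤ cKrullDim R :=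
  le_ciSup (f := fun C : {C : Set (Ideal R) // C.Nonempty ∧ IsPrimeIdealChain C} => chainLen C.1)
    Cardinal.bddAbove_of_small ⟨C, hne, hC⟩

lemma hasStrongCDim_of_mk_primes {R : Type u} [CommRing R] {c : Cardinal.{u}}
    (hchain : IsChain (· ≤ ·) {P : Ideal R | P.IsPrime})
    (hcard : #{P : Ideal R | P.IsPrime} = c + 1) : HasStrongCDim R c := by
  have hne : {P : Ideal R | P.IsPrime}.Nonempty := by
    rw [← Set.nonempty_coe_sort, ← Cardinal.mk_ne_zero_iff, hcard]
    simp
  have hC : IsPrimeIdealChain {P : Ideal R | P.IsPrime} := ⟨fun _ h => h, hchain⟩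
  have hlen := chainLen_eq_of_mk_eq_add_one hcard
  refine ⟨le_antisymm ?_ (hlen ▸ chainLen_le_cKrullDim hne hC), _, hne, hC, hlen⟩
  refine ciSup_le' fun C => chainLen_le_of_mk_le_add_one ?_
  rw [← hcard]
  exact Cardinal.mk_le_mk_of_subset fun P hP => C.2.2.1 P hP

lemma hasStrongCDim_zero_of_finite (R : Type u) [CommRing R] [Nontrivial R] [Finite R] :
    HasStrongCDim R 0 := by
  obtain ⟨M, hM⟩ := Ideal.exists_maximal R
  have hmax : ∀ P : Ideal R, P.IsPrime → P.IsMaximal := fun P _ => inferInstance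
  have key : ∀ C : Set (Ideal R), IsPrimeIdealChain C → chainLen C ≤ 0 := by
    refine fun C hC => chainLen_le_of_mk_le_add_one ?_
    rw [zero_add, Cardinal.mk_le_one_iff_set_subsingleton]
    intro P hP Q hQ
    rcases hC.2.total hP hQ with h | h
    · exact (hmax P (hC.1 P hP)).eq_of_le (hC.1 Q hQ).ne_top h
    · exact ((hmax Q (hC.1 Q hQ)).eq_of_le (hC.1 P hP).ne_top h).symm
  have hM' : IsPrimeIdealChain {M} :=
    ⟨fun P hP => by rw [Set.mem_singleton_iff.1 hP]; exact hM.isPrime,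
      Set.subsingleton_singleton.isChain⟩
  exact ⟨le_antisymm (ciSup_le' fun C => key C.1 C.2.2) zero_le, {M},
    Set.singleton_nonempty M, hM', le_antisymm (key _ hM') zero_le⟩

section ValuationPrimes

variable {R : Type*} [CommRing R] {Γ : Type*} [AddCommGroup Γ] [LinearOrder Γ]
  [IsOrderedAddMonoid Γ] (v : AddValuation R (WithTop Γ)) {I : Type*} (e : I → Γ)

lemma mem_of_addValuation_le_nsmul (hdvd : ∀ f g, v f ≤ v g → f ∣ g) {P : Ideal R}
    (hP : P.IsPrime) {f g : R} (hf : f ∈ P) (n : ℕ) (h : v f ≤ n • v g) : g ∈ P := by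
  rw [← v.map_pow] at h
  exact hP.mem_of_pow_mem n (P.mem_of_dvd (hdvd _ _ h) hf)

lemma isChain_ideals_of_addValuation (hdvd : ∀ f g, v f ≤ v g → f ∣ g) (S : Set (Ideal R)) :
    IsChain (· ≤ ·) S := by
  intro P _ Q _ _
  by_contra! h
  obtain ⟨f, hfP, hfQ⟩ := SetLike.not_le_iff_exists.1 h.1
  obtain ⟨g, hgQ, hgP⟩ := SetLike.not_le_iff_exists.1 h.2
  rcases le_total (v f) (v g) with hl | hl
  · exact hgP (P.mem_of_dvd (hdvd _ _ hl) hfP)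
  · exact hfQ (Q.mem_of_dvd (hdvd _ _ hl) hgQ)

/-- The indices `i` for which elements of value `e i` lie in `P`. -/
def primeSupport (P : Ideal R) : Set I := {i | ∃ f ∈ P, v f = e i}

lemma primeSupport_injOn (hdvd : ∀ f g, v f ≤ v g → f ∣ g) (hnonneg : ∀ f, 0 ≤ v f)
    (hsurj : ∀ γ : Γ, 0 ≤ γ → ∃ f, v f = γ) (he : ∀ i, 0 < e i)
    (harch : ∀ γ : Γ, 0 < γ → ∃ i, ∃ n m : ℕ, γ ≤ n • e i ∧ e i ≤ m • γ)
    (htop : ∀ f, v f = ⊤ → f = 0) :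
    Set.InjOn (primeSupport v e) {P : Ideal R | P.IsPrime} := by
  have key : ∀ P Q : Ideal R, P.IsPrime → Q.IsPrime →
      primeSupport v e P = primeSupport v e Q → P ≤ Q := by
    intro P Q hP hQ h f hf
    cases hγ : v f with
    | top => rw [htop f hγ]; exact Q.zero_mem
    | coe γ =>
      have h0 : 0 ≤ γ := by
        have := hnonneg f
        rw [hγ] at this
        exact_mod_cast this
      rcases h0.eq_or_lt with h0 | h0
      · subst h0
        refine absurd ((Ideal.eq_top_iff_one P).2 (P.mem_of_dvd (hdvd f 1 ?_) hf)) hP.ne_top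
        rw [hγ, v.map_one]
        exact le_rfl
      · obtain ⟨i, n, m, hn, hm⟩ := harch γ h0
        obtain ⟨g, hg⟩ := hsurj (e i) (he i).le
        have hgP : g ∈ P := by
          refine mem_of_addValuation_le_nsmul v hdvd hP hf n ?_
          rw [hγ, hg]
          exact_mod_cast hn
        have hi : i ∈ primeSupport v e P := ⟨g, hgP, hg⟩
        rw [h] at hi
        obtain ⟨g', hg'Q, hg'⟩ := hi
        refine mem_of_addValuation_le_nsmul v hdvd hQ hg'Q m ?_
        rw [hγ, hg']
        exact_mod_cast hm
  intro P hP Q hQ h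
  exact le_antisymm (key P Q hP hQ h) (key Q P hQ hP h.symm)

lemma isLowerSet_primeSupport [Preorder I] (hdvd : ∀ f g, v f ≤ v g → f ∣ g)
    (hsurj : ∀ γ : Γ, 0 ≤ γ → ∃ f, v f = γ) (he : ∀ i, 0 < e i) (hanti : Antitone e)
    (P : Ideal R) : IsLowerSet (primeSupport v e P) := by
  rintro j i hij ⟨f, hf, hfj⟩
  obtain ⟨g, hg⟩ := hsurj (e i) (he i).le
  refine ⟨g, P.mem_of_dvd (hdvd f g ?_) hf, hg⟩
  rw [hfj, hg]
  exact_mod_cast hanti hij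

/-- The prime ideal of elements which are zero or have a multiple of their value above `e i` for
some `i ∈ s`. -/
def primeOfSet (hnonneg : ∀ f, 0 ≤ v f) (s : Set I) : Ideal R where
  carrier := {f | f = 0 ∨ ∃ i ∈ s, ∃ n : ℕ, (e i : WithTop Γ) ≤ n • v f}
  zero_mem' := Or.inl rfl
  add_mem' := by
    rintro f g (rfl | ⟨i, hi, n, hn⟩) hg
    · simpa using hg
    rcases hg with rfl | ⟨j, hj, m, hm⟩
    · exact Or.inr ⟨i, hi, n, by simpa using hn⟩
    rcases v.map_add' f g with h | h
    · exact Or.inr ⟨i, hi, n, hn.trans (nsmul_le_nsmul_right h n)⟩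
    · exact Or.inr ⟨j, hj, m, hm.trans (nsmul_le_nsmul_right h m)⟩
  smul_mem' := by
    rintro c f (rfl | ⟨i, hi, n, hn⟩)
    · simp
    refine Or.inr ⟨i, hi, n, hn.trans (nsmul_le_nsmul_right ?_ n)⟩
    rw [smul_eq_mul, v.map_mul]
    exact le_add_of_nonneg_left (hnonneg c)

lemma isPrime_primeOfSet [IsDomain R] (hnonneg : ∀ f, 0 ≤ v f) (he : ∀ i, 0 < e i) (s : Set I) :
    (primeOfSet v e hnonneg s).IsPrime := by
  refine ⟨fun h => ?_, ?_⟩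
  · rcases (Ideal.eq_top_iff_one _).1 h with h | ⟨i, -, n, hn⟩
    · exact one_ne_zero h
    · rw [v.map_one, nsmul_zero] at hn
      exact (he i).not_ge (by exact_mod_cast hn)
  · rintro f g (h | ⟨i, hi, n, hn⟩)
    · exact (mul_eq_zero.1 h).imp Or.inl Or.inl
    rw [v.map_mul] at hn
    rcases le_total (v f) (v g) with h | h
    · refine Or.inr (Or.inr ⟨i, hi, n * 2, hn.trans ?_⟩)
      rw [mul_nsmul', two_nsmul]
      exact nsmul_le_nsmul_right (add_le_add_left h _) n
    · refine Or.inl (Or.inr ⟨i, hi, n * 2, hn.trans ?_⟩)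
      rw [mul_nsmul', two_nsmul]
      exact nsmul_le_nsmul_right (add_le_add_right h _) n

lemma primeSupport_primeOfSet [LinearOrder I] (hnonneg : ∀ f, 0 ≤ v f)
    (hsurj : ∀ γ : Γ, 0 ≤ γ → ∃ f, v f = γ) (he : ∀ i, 0 < e i)
    (hinf : ∀ i j, i < j → ∀ n : ℕ, n • e j < e i) {s : Set I} (hs : IsLowerSet s) :
    primeSupport v e (primeOfSet v e hnonneg s) = s := by
  ext j
  constructor
  · rintro ⟨f, rfl | ⟨i, hi, n, hn⟩, hf⟩
    · rw [v.map_zero] at hf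
      exact absurd hf.symm WithTop.coe_ne_top
    · rw [hf] at hn
      by_contra hj
      have hij : i < j := lt_of_not_ge fun h => hj (hs h hi)
      exact (hinf i j hij n).not_ge (by exact_mod_cast hn)
  · intro hj
    obtain ⟨f, hf⟩ := hsurj (e j) (he j).le
    exact ⟨f, Or.inr ⟨j, hj, 1, by rw [hf, one_nsmul]⟩, hf⟩

end ValuationPrimes

lemma mk_lowerSets_of_wellFounded (I : Type u) [LinearOrder I] [WellFoundedLT I] :
    #{s : Set I | IsLowerSet s} = #I + 1 := by
  rw [← Cardinal.mk_option]
  refine (Cardinal.mk_congr (Equiv.ofBijective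
    (fun t : Option I => (⟨t.elim Set.univ Set.Iio, ?_⟩ : {s : Set I | IsLowerSet s})) ?_)).symm
  · cases t
    · exact isLowerSet_univ
    · exact isLowerSet_Iio _
  · constructor
    · rintro (_ | a) (_ | b) h
      · rfl
      · have h' : Set.univ = Set.Iio b := congrArg Subtype.val h
        exact absurd (h'.subset (Set.mem_univ b)) (lt_irrefl b)
      · have h' : Set.Iio a = Set.univ := congrArg Subtype.val h
        exact absurd (h'.superset (Set.mem_univ a)) (lt_irrefl a)
      · have h' : Set.Iio a = Set.Iio b := congrArg Subtype.val h
        rw [Set.Iio_injective h']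
    · rintro ⟨s, hs⟩
      rcases IsLowerSet.eq_univ_or_Iio hs with rfl | ⟨a, rfl⟩
      · exact ⟨none, rfl⟩
      · exact ⟨some a, rfl⟩

lemma hasStrongCDim_of_addValuation {R : Type u} [CommRing R] [IsDomain R] {Γ : Type*}
    [AddCommGroup Γ] [LinearOrder Γ] [IsOrderedAddMonoid Γ] (v : AddValuation R (WithTop Γ))
    {I : Type u} [LinearOrder I] [WellFoundedLT I] (e : I → Γ)
    (hdvd : ∀ f g, v f ≤ v g → f ∣ g) (hnonneg : ∀ f, 0 ≤ v f)
    (hsurj : ∀ γ : Γ, 0 ≤ γ → ∃ f, v f = γ) (he : ∀ i, 0 < e i)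
    (harch : ∀ γ : Γ, 0 < γ → ∃ i, ∃ n m : ℕ, γ ≤ n • e i ∧ e i ≤ m • γ)
    (hinf : ∀ i j, i < j → ∀ n : ℕ, n • e j < e i) (htop : ∀ f, v f = ⊤ → f = 0) :
    HasStrongCDim R #I := by
  refine hasStrongCDim_of_mk_primes (isChain_ideals_of_addValuation v hdvd _) ?_
  have hanti : Antitone e := by
    intro i j hij
    rcases hij.eq_or_lt with rfl | h
    · exact le_rfl
    · simpa using (hinf i j h 1).le
  rw [← mk_lowerSets_of_wellFounded I]
  refine Cardinal.mk_congr (Set.BijOn.equiv (primeSupport v e) ⟨fun P _ => ?_, ?_, ?_⟩)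
  · exact isLowerSet_primeSupport v e hdvd hsurj he hanti P
  · exact primeSupport_injOn v e hdvd hnonneg hsurj he harch htop
  · exact fun s hs => ⟨primeOfSet v e hnonneg s, isPrime_primeOfSet v e hnonneg he s,
      primeSupport_primeOfSet v e hnonneg hsurj he hinf hs⟩

section LexGroup

lemma ofLex_nsmul_apply {I : Type*} (n : ℕ) (a : Lex (I →₀ ℤ)) (i : I) :
    ofLex (n • a) i = n * ofLex a i := by
  change (n • ofLex a) i = _
  simp

variable {I : Type*} [LinearOrder I]

lemma lex_single_pos (i : I) : 0 < (toLex (Finsupp.single i (1 : ℤ))) := by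
  rw [Finsupp.Lex.lt_iff]
  refine ⟨i, fun j hj => ?_, ?_⟩
  · simp [hj.ne']
  · simp

lemma nsmul_lex_single_lt {i j : I} (h : i < j) (n : ℕ) :
    n • toLex (Finsupp.single j (1 : ℤ)) < toLex (Finsupp.single i (1 : ℤ)) := by
  rw [Finsupp.Lex.lt_iff]
  refine ⟨i, fun k hk => ?_, ?_⟩
  · simp [ofLex_nsmul_apply, hk.ne', (hk.trans h).ne']
  · simp [ofLex_nsmul_apply, h.ne']

lemma exists_lex_single_archimedean (γ : Lex (I →₀ ℤ)) (h : 0 < γ) :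
    ∃ i, ∃ n m : ℕ, γ ≤ n • toLex (Finsupp.single i (1 : ℤ)) ∧
      toLex (Finsupp.single i (1 : ℤ)) ≤ m • γ := by
  obtain ⟨i, hi, hpos⟩ := Finsupp.Lex.lt_iff.1 h
  have hpos' : 0 < ofLex γ i := hpos
  have hi' : ∀ j < i, ofLex γ j = 0 := fun j hj => (hi j hj).symm
  refine ⟨i, (ofLex γ i).toNat + 1, 2, le_of_lt ?_, le_of_lt ?_⟩
  · rw [Finsupp.Lex.lt_iff]
    refine ⟨i, fun k hk => ?_, ?_⟩
    · simp [ofLex_nsmul_apply, hk.ne', hi' k hk]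
    · simp only [ofLex_nsmul_apply, ofLex_toLex, Finsupp.single_eq_same]
      omega
  · rw [Finsupp.Lex.lt_iff]
    refine ⟨i, fun k hk => ?_, ?_⟩
    · simp [ofLex_nsmul_apply, hk.ne', hi' k hk]
    · simp only [ofLex_nsmul_apply, ofLex_toLex, Finsupp.single_eq_same]
      omega

lemma mk_lex_finsupp_int_le (I : Type u) : #(Lex (I →₀ ℤ)) ≤ max #I ℵ₀ := by
  change #(I →₀ ℤ) ≤ _
  cases isEmpty_or_nonempty I
  · simp
  · simp [Cardinal.mk_finsupp_lift_of_infinite']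

end LexGroup

section MonomialSubring

variable (Γ : Type u) [AddCommGroup Γ] [LinearOrder Γ] [IsOrderedAddMonoid Γ]
  (K : Type u) [Field K]

/-- The field of Hahn series generated by constants and monomials. -/
noncomputable def monomialSubfield : Subfield (HahnSeries Γ K) :=
  Subfield.closure (Set.range HahnSeries.C ∪ Set.range fun γ : Γ => HahnSeries.single γ (1 : K))

/-- The series of nonnegative order in `monomialSubfield`. -/
noncomputable def monomialSubring : Subring (HahnSeries Γ K) where
  carrier := {f | f ∈ monomialSubfield Γ K ∧ 0 ≤ HahnSeries.addVal Γ K f}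
  zero_mem' := ⟨zero_mem _, by simp⟩
  one_mem' := ⟨one_mem _, by simp⟩
  add_mem' := fun hf hg => ⟨add_mem hf.1 hg.1, AddValuation.map_le_add _ hf.2 hg.2⟩
  mul_mem' := fun hf hg => ⟨mul_mem hf.1 hg.1, by
    rw [AddValuation.map_mul]; exact add_nonneg hf.2 hg.2⟩
  neg_mem' := fun hf => ⟨neg_mem hf.1, by rw [AddValuation.map_neg]; exact hf.2⟩

variable {Γ K}

lemma C_mem_monomialSubring (a : K) : HahnSeries.C a ∈ monomialSubring Γ K :=
  ⟨Subfield.subset_closure (Or.inl ⟨a, rfl⟩), by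
    rw [HahnSeries.addVal_apply]
    exact HahnSeries.orderTop_single_le⟩

lemma single_mem_monomialSubring {γ : Γ} (hγ : 0 ≤ γ) :
    HahnSeries.single γ (1 : K) ∈ monomialSubring Γ K :=
  ⟨Subfield.subset_closure (Or.inr ⟨γ, rfl⟩), by
    rw [HahnSeries.addVal_apply, HahnSeries.orderTop_single one_ne_zero]
    exact_mod_cast hγ⟩

lemma mk_monomialSubring [Infinite K] (h : #Γ ≤ #K) : #(monomialSubring Γ K) = #K := by
  refine le_antisymm ?_ ?_
  · have hK : ℵ₀ ≤ #K := Cardinal.aleph0_le_mk K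
    calc #(monomialSubring Γ K) ≤ #(monomialSubfield Γ K) :=
          Cardinal.mk_le_mk_of_subset fun f hf => hf.1
      _ ≤ _ := Subfield.cardinalMk_closure_le_max _
      _ ≤ #K := by
        refine max_le ((Cardinal.mk_union_le _ _).trans ?_) hK
        exact Cardinal.add_le_of_le hK Cardinal.mk_range_le (Cardinal.mk_range_le.trans h)
  · refine Cardinal.mk_le_of_injective
      (f := fun a => (⟨HahnSeries.C a, C_mem_monomialSubring a⟩ : monomialSubring Γ K)) ?_
    exact fun a b hab => HahnSeries.C_injective (congrArg Subtype.val hab)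

lemma dvd_of_addVal_le (f g : monomialSubring Γ K)
    (h : HahnSeries.addVal Γ K f ≤ HahnSeries.addVal Γ K g) : f ∣ g := by
  rcases eq_or_ne f 0 with rfl | hf
  · have hg : (g : HahnSeries Γ K) = 0 := by
      simpa [HahnSeries.addVal_apply] using h
    rw [show g = 0 from Subtype.ext hg]
  · have hf' : (f : HahnSeries Γ K) ≠ 0 := fun h => hf (Subtype.ext h)
    have hmul : (f : HahnSeries Γ K) * (g / f) = g := mul_div_cancel₀ _ hf'
    refine ⟨⟨g / f, div_mem g.2.1 f.2.1, ?_⟩, Subtype.ext hmul.symm⟩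
    rw [← hmul, AddValuation.map_mul, HahnSeries.addVal_apply_of_ne hf'] at h
    refine (WithTop.add_le_add_iff_left WithTop.coe_ne_top).1 (h.trans' (add_zero _).le)

end MonomialSubring

lemma hasStrongCDim_monomialSubring (I : Type u) [LinearOrder I] [WellFoundedLT I]
    (K : Type u) [Field K] : HasStrongCDim (monomialSubring (Lex (I →₀ ℤ)) K) #I := by
  refine hasStrongCDim_of_addValuation
    ((HahnSeries.addVal (Lex (I →₀ ℤ)) K).comap (monomialSubring (Lex (I →₀ ℤ)) K).subtype)
    (fun i => toLex (Finsupp.single i (1 : ℤ))) dvd_of_addVal_le (fun f => f.2.2)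
    (fun γ hγ => ⟨⟨_, single_mem_monomialSubring hγ⟩, ?_⟩) lex_single_pos
    exists_lex_single_archimedean (fun _ _ h n => nsmul_lex_single_lt h n) fun f hf => ?_
  · exact HahnSeries.addVal_apply.trans (HahnSeries.orderTop_single one_ne_zero)
  · exact Subtype.ext (HahnSeries.orderTop_eq_top.1 (HahnSeries.addVal_apply.symm.trans hf))

lemma exists_commRing_hasStrongCDim {κ lam : Cardinal.{u}} (hle : lam ≤ κ) (h2 : 2 ≤ κ)
    (hfin : κ < ℵ₀ → lam = 0) :
    ∃ (R : Type u) (_ : CommRing R) (_ : Nontrivial R), #R = κ ∧ HasStrongCDim R lam := by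
  rcases lt_or_ge κ ℵ₀ with hκ | hκ
  · rw [hfin hκ]
    obtain ⟨n, rfl⟩ := Cardinal.lt_aleph0.1 hκ
    have hn : 2 ≤ n := by exact_mod_cast h2
    have : NeZero n := ⟨by omega⟩
    have : Fact (1 < n) := ⟨hn⟩
    exact ⟨ULift.{u} (ZMod n), inferInstance, inferInstance, by simp,
      hasStrongCDim_zero_of_finite _⟩
  · obtain ⟨K, rfl⟩ : ∃ K : Type u, #K = κ := ⟨κ.out, κ.mk_out⟩
    have : Infinite K := Cardinal.infinite_iff.2 hκ
    obtain ⟨_⟩ := Infinite.nonempty_field (α := K)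
    have hI : #lam.ord.ToType = lam := by simp
    refine ⟨monomialSubring (Lex (lam.ord.ToType →₀ ℤ)) K, inferInstance, inferInstance,
      mk_monomialSubring ?_, ?_⟩
    · exact (mk_lex_finsupp_int_le _).trans (max_le (hI.trans_le hle) hκ)
    · simpa only [hI] using hasStrongCDim_monomialSubring lam.ord.ToType K

/-- For cardinals `κ ≥ λ`, there is a commutative unital ring (with `1 ≠ 0`)
of cardinality `κ` and cardinal Krull dimension `λ` iff `κ ≥ 2` and (`κ` finite → `λ = 0`);
moreover in that case the ring may be chosen with strong cardinal Krull dimension `λ`. -/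
theorem stmt1 (κ lam : Cardinal.{u}) (hle : lam ≤ κ) :
    ((∃ (R : Type u) (_ : CommRing R) (_ : Nontrivial R), #R = κ ∧ cKrullDim R = lam) ↔
      (2 ≤ κ ∧ (κ < ℵ₀ → lam = 0))) ∧
    ((2 ≤ κ ∧ (κ < ℵ₀ → lam = 0)) →
      ∃ (R : Type u) (_ : CommRing R) (_ : Nontrivial R), #R = κ ∧ HasStrongCDim R lam) := by
  refine ⟨⟨?_, fun h => ?_⟩, fun h => exists_commRing_hasStrongCDim hle h.1 h.2⟩
  · rintro ⟨R, _, _, rfl, rfl⟩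
    refine ⟨Cardinal.two_le_iff.2 (exists_pair_ne R), fun hR => ?_⟩
    have : Finite R := Cardinal.lt_aleph0_iff_finite.1 hR
    exact (hasStrongCDim_zero_of_finite R).1
  · obtain ⟨R, hR, hR', hcard, hdim, -⟩ := exists_commRing_hasStrongCDim hle h.1 h.2
    exact ⟨R, hR, hR', hcard, hdim⟩
end

section
/- For every infinite cardinal κ there exists a commutative integral domain V of cardinality κ that is a valuation ring and possesses a chain of prime ideals of cardinality strictly greater than κ (in particular, of cardinality at least κ⁺). -/
universe u
open Cardinal

/-- In a valuation ring, the radical of a proper ideal is prime. -/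
theorem isPrime_radical_of_ne_top {R : Type*} [CommRing R] [IsDomain R] [ValuationRing R]
    {I : Ideal R} (hI : I ≠ ⊤) : I.radical.IsPrime := by
  refine ⟨fun h ↦ hI (Ideal.radical_eq_top.mp h), fun {a b} hab ↦ ?_⟩
  have key {a b : R} (hab : a * b ∈ I.radical) (h : a ∣ b) : b ∈ I.radical := by
    obtain ⟨c, rfl⟩ := h
    refine (Ideal.radical_isRadical I) ⟨2, ?_⟩
    have := I.radical.mul_mem_right c hab
    convert this using 1
    ring
  rcases ValuationRing.dvd_total a b with h | h
  · exact Or.inr (key hab h)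
  · exact Or.inl (key (mul_comm a b ▸ hab) h)

/-- In a valuation ring, a nonzero element of the ideal spanned by a set is a multiple of
an element of that set. -/
theorem eq_zero_or_exists_dvd_of_mem_span {R : Type*} [CommRing R] [IsDomain R]
    [ValuationRing R] {S : Set R} {x : R} (hx : x ∈ Ideal.span S) :
    x = 0 ∨ ∃ s ∈ S, s ∣ x := by
  induction hx using Submodule.span_induction with
  | mem x hx => exact Or.inr ⟨x, hx, dvd_rfl⟩
  | zero => exact Or.inl rfl
  | add x y _ _ hx hy =>
    obtain rfl | ⟨s, hs, hsx⟩ := hx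
    · simpa using hy
    obtain rfl | ⟨t, ht, hty⟩ := hy
    · exact Or.inr ⟨s, hs, by simpa using hsx⟩
    rcases ValuationRing.dvd_total s t with h | h
    · exact Or.inr ⟨s, hs, dvd_add hsx (h.trans hty)⟩
    · exact Or.inr ⟨t, ht, dvd_add (h.trans hsx) hty⟩
  | smul a x _ hx =>
    obtain rfl | ⟨s, hs, hsx⟩ := hx
    · simp
    · exact Or.inr ⟨s, hs, hsx.mul_left a⟩

/-- Over every infinite linear order `T` there is a valuation ring of cardinality `#T` containing
nonzero nonunits indexed by `T`, each of which divides no power of any later one. -/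
theorem exists_valuationRing_monomials (T : Type u) [LinearOrder T] [Infinite T] :
    ∃ (V : Type u) (_ : CommRing V) (_ : IsDomain V) (_ : ValuationRing V), #V = #T ∧
      ∃ m : T → V, (∀ t, m t ≠ 0) ∧ (∀ t, ¬ IsUnit (m t)) ∧
        ∀ s t, s < t → ∀ n : ℕ, ¬ m s ∣ m t ^ n := by
  let Γ := Lex (T →₀ ℤ)
  let e (t : T) : Γ := toLex (Finsupp.single t 1)
  have he (t : T) : 0 < e t := by
    refine Finsupp.Lex.lt_iff.mpr ⟨t, fun j hj ↦ ?_, ?_⟩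
    · simp [e, hj.ne']
    · simp [e]
  have hlt (s t : T) (hst : s < t) (n : ℕ) : n • e t < e s := by
    have hn : n • e t = toLex (Finsupp.single t (n : ℤ)) := by
      change toLex (n • Finsupp.single t (1 : ℤ)) = _
      simp
    rw [hn]
    refine Finsupp.Lex.lt_iff.mpr ⟨s, fun j hj ↦ ?_, ?_⟩
    · simp [e, hj.ne', (hj.trans hst).ne']
    · simp [e, hst.ne']
  let μ (t : T) : HahnSeries Γ ℚ := HahnSeries.single (e t) 1
  let F : Subfield (HahnSeries Γ ℚ) := Subfield.closure (Set.range μ)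
  let v : AddValuation F (WithTop Γ) := (HahnSeries.addVal Γ ℚ).comap F.subtype
  let V := v.toValuation.valuationSubring
  have hv (x : V) : 0 ≤ v x := x.2
  let m (t : T) : V := ⟨⟨μ t, Subfield.subset_closure ⟨t, rfl⟩⟩, by
    change 0 ≤ HahnSeries.addVal Γ ℚ (μ t)
    rw [HahnSeries.addVal_apply, HahnSeries.orderTop_single one_ne_zero]
    exact_mod_cast (he t).le⟩
  have hvm (t : T) : v (m t) = e t := by
    change HahnSeries.addVal Γ ℚ (μ t) = _
    rw [HahnSeries.addVal_apply, HahnSeries.orderTop_single one_ne_zero]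
  have hdvd {x y : V} (h : x ∣ y) : v x ≤ v y := by
    obtain ⟨c, rfl⟩ := h
    simpa using le_add_of_nonneg_right (a := v x) (hv c)
  have hm (s t : T) (hst : s < t) (n : ℕ) : ¬ m s ∣ m t ^ n := fun h ↦ by
    have h1 := hdvd h
    rw [SubmonoidClass.coe_pow, AddValuation.map_pow, hvm, hvm] at h1
    exact (hlt s t hst n).not_ge (by exact_mod_cast h1)
  have hinj : Function.Injective m := Function.Injective.of_lt_imp_ne fun s t hst h ↦
    hm s t hst 1 (by rw [h, pow_one])
  refine ⟨V, inferInstance, inferInstance, inferInstance, le_antisymm ?_ ?_, m, fun t h ↦ ?_,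
    fun t h ↦ ?_, hm⟩
  · calc #V ≤ #F := Cardinal.mk_le_of_injective Subtype.val_injective
      _ ≤ max #(Set.range μ) ℵ₀ := Subfield.cardinalMk_closure_le_max _
      _ ≤ #T := max_le Cardinal.mk_range_le (Cardinal.aleph0_le_mk T)
  · exact Cardinal.mk_le_of_injective hinj
  · have := hvm t
    simp [h] at this
  · have h1 := hdvd (isUnit_iff_dvd_one.mp h)
    rw [hvm, OneMemClass.coe_one, AddValuation.map_one] at h1
    exact (he t).not_ge (by exact_mod_cast h1)

/-- Every infinite cardinal `κ` is the cardinality of a subset `A` separating the points of a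
linear order with more than `κ` elements. -/
theorem exists_linearOrder_lt_mk (κ : Cardinal.{u}) (hκ : ℵ₀ ≤ κ) :
    ∃ (X : Type u) (_ : LinearOrder X) (A : Set X), #A = κ ∧ κ < #X ∧
      ∀ x y : X, x < y → ∃ a : A, x < a.1 ∧ a.1 ≤ y := by
  obtain ⟨μ, hμ, hmin⟩ := WellFounded.has_min (wellFounded_lt (α := Cardinal.{u}))
    {μ | κ < 2 ^ μ} ⟨κ, Cardinal.cantor κ⟩
  have hμκ : μ ≤ κ := not_lt.mp (hmin κ (Cardinal.cantor κ))
  let I := μ.ord.ToType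
  let X := Lex (I → Bool)
  have hX : κ < #X := by
    have : #X = 2 ^ μ := by
      change #(I → Bool) = _
      simp [I]
    rwa [this]
  let d (p : Σ i : I, (Set.Iio i → Bool)) : X :=
    toLex fun j ↦ if h : j < p.1 then p.2 ⟨j, h⟩ else decide (j = p.1)
  have hd : #(Set.range d) ≤ κ := by
    refine Cardinal.mk_range_le.trans ?_
    rw [Cardinal.mk_sigma]
    have hle (i : I) : #(Set.Iio i → Bool) ≤ κ := by
      refine not_lt.mp fun h ↦ hmin #(Set.Iio i) ?_ ?_
      · simpa using h
      · simpa [I] using Cardinal.mk_Iio_lt i (by simp [I])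
    calc Cardinal.sum (fun i : I ↦ #(Set.Iio i → Bool)) ≤ Cardinal.sum fun _ : I ↦ κ :=
          Cardinal.sum_le_sum _ _ hle
      _ = μ * κ := by simp [I]
      _ ≤ κ * κ := by gcongr
      _ = κ := Cardinal.mul_eq_self hκ
  obtain ⟨B, hB⟩ := Cardinal.le_mk_iff_exists_set.mp hX.le
  refine ⟨X, inferInstance, Set.range d ∪ B, le_antisymm ?_ ?_, hX, fun x y hxy ↦ ?_⟩
  · exact (Cardinal.mk_union_le _ _).trans (Cardinal.add_le_of_le hκ hd hB.le)
  · exact hB.symm.le.trans (Cardinal.mk_le_mk_of_subset Set.subset_union_right)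
  · obtain ⟨i, heq, hi⟩ := hxy
    obtain ⟨hxi, hyi⟩ := Bool.lt_iff.mp hi
    refine ⟨⟨d ⟨i, fun j ↦ ofLex y j⟩, Or.inl ⟨_, rfl⟩⟩, ⟨i, fun j hj ↦ ?_, ?_⟩,
      Pi.toLex_monotone fun j ↦ ?_⟩
    · exact (heq j hj).trans (by simp [d, show j < i from hj])
    · simpa [d, Bool.lt_iff] using hxi
    · rcases lt_trichotomy j i with hj | rfl | hj
      · simp [hj]
      · simp [hyi]
      · simp [hj.not_gt, hj.ne']

/-- For every infinite cardinal `κ` there is a valuation ring (a commutative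
integral domain whose ideals are totally ordered by inclusion) of cardinality `κ` having a
chain of prime ideals of cardinality strictly greater than `κ` (equivalently, `≥ κ⁺`). -/
theorem stmt3 (κ : Cardinal.{u}) (hκ : ℵ₀ ≤ κ) :
    ∃ (V : Type u) (_ : CommRing V) (_ : IsDomain V) (_ : ValuationRing V),
      #V = κ ∧ ∃ C : Set (Ideal V), IsPrimeIdealChain C ∧ κ < #C := by
  obtain ⟨X, _, A, hA, hX, hsep⟩ := exists_linearOrder_lt_mk κ hκ
  have : Infinite A := by rwa [Cardinal.infinite_iff, hA]
  obtain ⟨V, _, _, _, hV, m, h0, hu, hm⟩ := exists_valuationRing_monomials A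
  refine ⟨V, _, inferInstance, inferInstance, hV.trans hA, ?_⟩
  let P (x : X) : Ideal V := (Ideal.span (m '' {a | a.1 ≤ x})).radical
  have hmono : Monotone P := fun x y hxy ↦
    Ideal.radical_mono (Ideal.span_mono (Set.image_mono fun a ha ↦ le_trans ha hxy))
  have hP : Function.Injective P := by
    refine .of_lt_imp_ne fun x y hxy h ↦ ?_
    obtain ⟨a, hxa, hay⟩ := hsep x y hxy
    have ha : m a ∈ P y := Ideal.le_radical (Ideal.subset_span ⟨a, hay, rfl⟩)
    rw [← h] at ha
    obtain ⟨n, hn⟩ := ha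
    obtain hz | ⟨_, ⟨b, hb, rfl⟩, hdvd⟩ := eq_zero_or_exists_dvd_of_mem_span hn
    · exact pow_ne_zero n (h0 a) hz
    · exact hm b a (lt_of_le_of_lt (b := x) hb hxa : b.1 < a.1) n hdvd
  refine ⟨Set.range P, ⟨?_, hmono.isChain_range⟩, ?_⟩
  · rintro _ ⟨x, rfl⟩
    refine isPrime_radical_of_ne_top fun h ↦ ?_
    rw [Ideal.eq_top_iff_one] at h
    obtain hz | ⟨_, ⟨b, hb, rfl⟩, hdvd⟩ := eq_zero_or_exists_dvd_of_mem_span h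
    · exact one_ne_zero hz
    · exact hu b (isUnit_of_dvd_one hdvd)
  · rwa [Cardinal.mk_range_eq _ hP]
end

section
/- Let κ be a pseudo strong limit (PSL) cardinal, i.e., an infinite cardinal such that 2^α ≤ κ for every cardinal α < κ. Then there exists a commutative integral domain V of cardinality κ that is a valuation ring and possesses a chain of prime ideals of cardinality 2^κ. -/
universe u
open Cardinal

section LexValuation

variable {X : Type*} [LinearOrder X]

theorem exists_mem_lowerSet_ne_zero_of_le (S : LowerSet X) {a b : Lex (X →₀ ℤ)} (ha : 0 ≤ a)
    (hab : a ≤ b) (h : ∃ i ∈ S, ofLex a i ≠ 0) : ∃ i ∈ S, ofLex b i ≠ 0 := by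
  by_contra! hb
  obtain ⟨i, hiS, hi⟩ := h
  have ha0 : a ≠ 0 := by
    rintro rfl
    exact hi rfl
  obtain ⟨j, hj, hj'⟩ := Finsupp.Lex.lt_iff.1 (lt_of_le_of_ne ha ha0.symm)
  have hji : j ≤ i := by
    by_contra! hij
    exact hi (hj i hij).symm
  refine hab.not_gt (Finsupp.Lex.lt_iff.2 ⟨j, fun k hk => ?_, ?_⟩)
  · rw [hb k (S.lower (hk.le.trans hji) hiS), ← hj k hk]
    rfl
  · rw [hb j (S.lower hji hiS)]
    exact hj'

variable {K : Type*} [Field K] (v : AddValuation K (WithTop (Lex (X →₀ ℤ))))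

theorem mem_valuationSubring_iff_nonneg (x : K) : x ∈ v.valuationSubring ↔ 0 ≤ v x := Iff.rfl

theorem lexValue_support_mono (S : LowerSet X) {x y : K} (hx : 0 ≤ v x) (hxy : v x ≤ v y)
    (h : ∀ γ : Lex (X →₀ ℤ), v x = γ → ∃ i ∈ S, ofLex γ i ≠ 0) :
    ∀ γ : Lex (X →₀ ℤ), v y = γ → ∃ i ∈ S, ofLex γ i ≠ 0 := by
  intro γ hγ
  rw [hγ] at hxy
  obtain ⟨α, hα, hαγ⟩ := WithTop.le_coe_iff.1 hxy
  refine exists_mem_lowerSet_ne_zero_of_le S ?_ hαγ (h α hα)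
  rw [hα] at hx
  exact_mod_cast hx

/-- The ideal of elements whose value has a nonzero coordinate in the lower set `S`. -/
def lexIdeal (S : LowerSet X) : Ideal v.valuationSubring where
  carrier := {x | ∀ γ : Lex (X →₀ ℤ), v x = γ → ∃ i ∈ S, ofLex γ i ≠ 0}
  zero_mem' γ hγ := by simp at hγ
  add_mem' {x y} hx hy := by
    rcases min_le_iff.1 (v.map_add (x : K) y) with h | h
    · exact lexValue_support_mono v S x.2 h hx
    · exact lexValue_support_mono v S y.2 h hy
  smul_mem' c x hx := by
    refine lexValue_support_mono v S x.2 ?_ hx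
    have h : v ((c • x : v.valuationSubring) : K) = v c + v x := v.map_mul _ _
    rw [h]
    exact le_add_of_nonneg_left c.2

theorem mem_lexIdeal {S : LowerSet X} {x : v.valuationSubring} :
    x ∈ lexIdeal v S ↔ ∀ γ : Lex (X →₀ ℤ), v x = γ → ∃ i ∈ S, ofLex γ i ≠ 0 := Iff.rfl

theorem lexIdeal_isPrime (S : LowerSet X) : (lexIdeal v S).IsPrime := by
  refine Ideal.isPrime_iff.2 ⟨fun h => ?_, fun {x y} hxy => ?_⟩
  · obtain ⟨i, -, hi⟩ := (mem_lexIdeal v).1 ((Ideal.eq_top_iff_one _).1 h) 0 v.map_one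
    exact hi rfl
  · by_contra! h
    simp only [mem_lexIdeal] at h
    push Not at h
    obtain ⟨⟨α, hα, hα'⟩, ⟨β, hβ, hβ'⟩⟩ := h
    have hv : v ((x * y : v.valuationSubring) : K) = ((α + β : Lex (X →₀ ℤ)) : WithTop _) := by
      rw [WithTop.coe_add, ← hα, ← hβ]
      exact v.map_mul _ _
    obtain ⟨i, hiS, hi⟩ := (mem_lexIdeal v).1 hxy _ hv
    apply hi
    change ofLex α i + ofLex β i = 0
    rw [hα' i hiS, hβ' i hiS, add_zero]

theorem single_one_pos (i : X) : (0 : Lex (X →₀ ℤ)) < toLex (Finsupp.single i 1) := by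
  classical
  refine Finsupp.Lex.lt_iff.2 ⟨i, fun j hj => ?_, ?_⟩
  · exact (Finsupp.single_eq_of_ne (b := (1 : ℤ)) hj.ne).symm
  · change (0 : ℤ) < Finsupp.single i 1 i
    simp

theorem lexIdeal_injective
    (hv : ∀ i : X, ∃ x, v x = (toLex (Finsupp.single i 1) : Lex (X →₀ ℤ))) :
    Function.Injective (lexIdeal v) := by
  have key : ∀ S T : LowerSet X, lexIdeal v S ≤ lexIdeal v T → S ≤ T := by
    intro S T h i hi
    obtain ⟨x, hx⟩ := hv i
    have hx0 : x ∈ v.valuationSubring := by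
      rw [mem_valuationSubring_iff_nonneg, hx]
      exact_mod_cast (single_one_pos i).le
    have hxS : (⟨x, hx0⟩ : v.valuationSubring) ∈ lexIdeal v S := by
      intro γ hγ
      obtain rfl := WithTop.coe_injective (hx.symm.trans hγ)
      refine ⟨i, hi, ?_⟩
      change Finsupp.single i (1 : ℤ) i ≠ 0
      simp
    obtain ⟨j, hj, hj'⟩ := h hxS _ hx
    have hji : j = i := by
      by_contra hne
      exact hj' (Finsupp.single_eq_of_ne hne)
    exact hji ▸ hj
  exact fun S T h => le_antisymm (key S T h.le) (key T S h.ge)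

end LexValuation

/-- A linear order `X` of infinite cardinality is the index set of the value group of a valuation
ring of the same cardinality, whose prime ideals include a chain indexed by the lower sets
of `X`. -/
theorem exists_valuationRing_chain_lowerSet (X : Type u) [LinearOrder X] [Infinite X] :
    ∃ (V : Type u) (_ : CommRing V) (_ : IsDomain V) (_ : ValuationRing V),
      #V = #X ∧ ∃ C : Set (Ideal V), IsPrimeIdealChain C ∧ #C = #(LowerSet X) := by
  let t : X → HahnSeries (Lex (X →₀ ℤ)) ℚ := fun i =>
    HahnSeries.single (toLex (Finsupp.single i 1)) 1
  let K := Subfield.closure (Set.range t)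
  let v : AddValuation K (WithTop (Lex (X →₀ ℤ))) :=
    (HahnSeries.addVal (Lex (X →₀ ℤ)) ℚ).comap K.subtype
  let s : X → K := fun i => ⟨t i, Subfield.subset_closure ⟨i, rfl⟩⟩
  have hs : ∀ i, v (s i) = (toLex (Finsupp.single i 1) : Lex (X →₀ ℤ)) := fun i =>
    HahnSeries.addVal_apply.trans (HahnSeries.orderTop_single one_ne_zero)
  have hs_inj : Function.Injective s := by
    intro i j h
    have h1 := hs i
    rw [h, hs j] at h1
    exact (Finsupp.single_left_injective one_ne_zero
      (toLex.injective (WithTop.coe_injective h1))).symm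
  have hs_mem : ∀ i, s i ∈ v.valuationSubring := by
    intro i
    rw [mem_valuationSubring_iff_nonneg, hs]
    exact_mod_cast (single_one_pos i).le
  refine ⟨v.valuationSubring, inferInstance, inferInstance, inferInstance, ?_,
    Set.range (lexIdeal v), ⟨?_, ?_⟩, ?_⟩
  · apply le_antisymm
    · refine (mk_le_of_injective Subtype.val_injective).trans
        ((Subfield.cardinalMk_closure_le_max _).trans (max_le mk_range_le (aleph0_le_mk X)))
    · exact mk_le_of_injective (f := fun i => (⟨s i, hs_mem i⟩ : v.valuationSubring))
        fun i j h => hs_inj (congrArg Subtype.val h)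
  · rintro _ ⟨S, rfl⟩
    exact lexIdeal_isPrime v S
  · exact fun P _ Q _ _ => (ValuationRing.iff_ideal_total.1 inferInstance).total P Q
  · exact mk_range_eq _ (lexIdeal_injective v fun i => ⟨s i, hs i⟩)

section Sequences

variable (I : Type u) [LinearOrder I]

/-- The binary sequences indexed by `I` with bounded support, ordered lexicographically. -/
def BoundedBinarySeq : Type u :=
  {f : Lex (I → Bool) // ∃ b, ∀ i, b < i → f i = false}

noncomputable instance [WellFoundedLT I] : LinearOrder (BoundedBinarySeq I) :=
  inferInstanceAs (LinearOrder {f : Lex (I → Bool) // ∃ b, ∀ i, b < i → f i = false})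

variable {I}

/-- The lower set of bounded binary sequences that are lexicographically at most `f`. -/
def lowerSetOfSeq [WellFoundedLT I] (f : Lex (I → Bool)) : LowerSet (BoundedBinarySeq I) where
  carrier := {x | x.1 ≤ f}
  lower' _ _ h hx := le_trans (Subtype.coe_le_coe.2 h) hx

theorem lowerSetOfSeq_injective [WellFoundedLT I] : Function.Injective (lowerSetOfSeq (I := I)) := by
  classical
  have key : ∀ f g : Lex (I → Bool), f < g → lowerSetOfSeq f ≠ lowerSetOfSeq g := by
    rintro f g ⟨d, hd, hfg⟩ h
    let x : BoundedBinarySeq I :=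
      ⟨toLex fun i => if i ≤ d then g i else false, d, fun i hi => if_neg hi.not_ge⟩
    have hxg : x.1 ≤ g := by
      refine Pi.toLex_monotone (show (fun i => if i ≤ d then g i else false) ≤ ofLex g from ?_)
      intro i
      dsimp only
      split_ifs
      · exact le_rfl
      · exact Bool.false_le _
    have hfx : f < x.1 := by
      refine ⟨d, fun j hj => ?_, ?_⟩
      · exact (hd j hj).trans (if_pos hj.le).symm
      · exact hfg.trans_eq (if_pos le_rfl).symm
    have : x ∈ lowerSetOfSeq f := h ▸ (show x ∈ lowerSetOfSeq g from hxg)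
    exact hfx.not_ge this
  intro f g h
  by_contra hne
  rcases lt_or_gt_of_ne hne with h' | h'
  · exact key _ _ h' h
  · exact key _ _ h' h.symm

theorem mk_le_mk_boundedBinarySeq : #I ≤ #(BoundedBinarySeq I) := by
  classical
  refine mk_le_of_injective
    (f := fun i => (⟨toLex fun j => decide (j = i), i, fun j hj => by simp [hj.ne']⟩ :
      BoundedBinarySeq I)) fun i j h => ?_
  have h1 : decide (i = i) = decide (i = j) := congrFun (congrArg Subtype.val h) i
  simpa using h1

theorem mk_boundedBinarySeq_le (hI : ℵ₀ ≤ #I) (h : ∀ b : I, 2 ^ #(Set.Iic b) ≤ #I) :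
    #(BoundedBinarySeq I) ≤ #I := by
  let e : BoundedBinarySeq I → Σ b : I, (Set.Iic b → Bool) := fun x =>
    ⟨x.2.choose, fun i => x.1 i⟩
  have he : Function.Injective e := by
    intro x y hxy
    have hb : x.2.choose = y.2.choose := congrArg Sigma.fst hxy
    have hf : ∀ i, i ≤ x.2.choose → x.1 i = y.1 i := by
      have aux : ∀ p q : Σ b : I, (Set.Iic b → Bool), p = q →
          ∀ i (hp : i ≤ p.1) (hq : i ≤ q.1), p.2 ⟨i, hp⟩ = q.2 ⟨i, hq⟩ := by
        rintro p _ rfl i _ _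
        rfl
      exact fun i hi => aux _ _ hxy i hi (hi.trans_eq hb)
    refine Subtype.ext (funext fun i => ?_)
    rcases le_or_gt i x.2.choose with hi | hi
    · exact hf i hi
    · rw [x.2.choose_spec i hi, y.2.choose_spec i (hb ▸ hi)]
  calc #(BoundedBinarySeq I) ≤ #(Σ b : I, (Set.Iic b → Bool)) := mk_le_of_injective he
    _ = Cardinal.sum fun b : I => 2 ^ #(Set.Iic b) := by simp
    _ ≤ Cardinal.sum fun _ : I => #I := sum_le_sum _ _ h
    _ = #I := by rw [sum_const', mul_eq_self hI]

end Sequences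

/-- For every pseudo strong limit cardinal `κ` (infinite with `2 ^ α ≤ κ` for
all `α < κ`) there is a valuation ring of cardinality `κ` having a chain of prime ideals of
cardinality `2 ^ κ`. -/
theorem stmt4 (κ : Cardinal.{u}) (hκ : ℵ₀ ≤ κ)
    (hpsl : ∀ α : Cardinal.{u}, α < κ → 2 ^ α ≤ κ) :
    ∃ (V : Type u) (_ : CommRing V) (_ : IsDomain V) (_ : ValuationRing V),
      #V = κ ∧ ∃ C : Set (Ideal V), IsPrimeIdealChain C ∧ #C = 2 ^ κ := by
  have hI : ℵ₀ ≤ #κ.ord.ToType := by rwa [mk_ord_toType]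
  have hIic : ∀ b : κ.ord.ToType, 2 ^ #(Set.Iic b) ≤ #κ.ord.ToType := by
    intro b
    rw [mk_ord_toType]
    apply hpsl
    have hb : #(Set.Iio b) < κ := by simpa using mk_Iio_lt b
    rw [← Set.Iio_insert]
    exact mk_insert_le.trans_lt (add_lt_of_lt hκ hb (one_lt_aleph0.trans_le hκ))
  have hX : #(BoundedBinarySeq κ.ord.ToType) = κ :=
    ((mk_boundedBinarySeq_le hI hIic).antisymm mk_le_mk_boundedBinarySeq).trans (mk_ord_toType κ)
  have : Infinite (BoundedBinarySeq κ.ord.ToType) := infinite_iff.2 (hκ.trans_eq hX.symm)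
  have hlower : #(LowerSet (BoundedBinarySeq κ.ord.ToType)) = 2 ^ κ := by
    apply le_antisymm
    · calc #(LowerSet (BoundedBinarySeq κ.ord.ToType))
          ≤ #(Set (BoundedBinarySeq κ.ord.ToType)) := mk_le_of_injective SetLike.coe_injective
        _ = 2 ^ κ := by rw [mk_set, hX]
    · calc (2 : Cardinal) ^ κ = #(κ.ord.ToType → Bool) := by simp
        _ ≤ _ := mk_le_of_injective lowerSetOfSeq_injective
  obtain ⟨V, hR, hD, hV, hc, hC⟩ :=
    exists_valuationRing_chain_lowerSet (BoundedBinarySeq κ.ord.ToType)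
  exact ⟨V, hR, hD, hV, hc.trans hX, hlower ▸ hC⟩
end

section
/- Assume the Generalized Continuum Hypothesis, i.e., 2^μ = μ⁺ for every infinite cardinal μ. Then for every infinite cardinal κ there exists a commutative integral domain V of cardinality κ that is a valuation ring and possesses a chain of prime ideals of cardinality 2^κ. -/
universe u
open Cardinal

namespace ValuationRing

theorem isPrime_radical {V : Type u} [CommRing V] [IsDomain V] [ValuationRing V] {I : Ideal V} (hI : I ≠ ⊤) : I.radical.IsPrime := by
  refine Ideal.isPrime_iff.2 ⟨fun h => hI (Ideal.radical_eq_top.1 h), ?_⟩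
  intro a b hab
  have key : ∀ a b : V, a ∣ b → a * b ∈ I.radical → b ∈ I.radical := fun a b hd h =>
    Ideal.radical_isRadical I
      ⟨2, by rw [sq]; exact Ideal.mem_of_dvd _ (mul_dvd_mul_right hd b) h⟩
  rcases ValuationRing.dvd_total a b with h | h
  · exact Or.inr (key a b h hab)
  · exact Or.inl (key b a h (by rwa [mul_comm]))

variable {V : Type u} [CommRing V] {L : Type u} [LinearOrder L] {x : L → V}

theorem exists_dvd_of_mem_span (hdvd : ∀ m l, m < l → ∀ n : ℕ, x l ^ n ∣ x m) {S : Set L} {y : V}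
    (hy : y ∈ Ideal.span (x '' S)) : y = 0 ∨ ∃ m ∈ S, x m ∣ y := by
  have hle : ∀ m l, m ≤ l → x l ∣ x m := fun m l h => by
    rcases h.eq_or_lt with rfl | h
    · exact dvd_rfl
    · simpa using hdvd m l h 1
  induction hy using Submodule.span_induction with
  | mem y h =>
    obtain ⟨m, hm, rfl⟩ := h
    exact Or.inr ⟨m, hm, dvd_rfl⟩
  | zero => exact Or.inl rfl
  | add a b _ _ ha hb =>
    rcases ha with rfl | ⟨m, hm, ha⟩
    · simpa using hb
    rcases hb with rfl | ⟨l, hl, hb⟩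
    · exact Or.inr ⟨m, hm, by simpa using ha⟩
    rcases le_total m l with h | h
    · exact Or.inr ⟨l, hl, dvd_add ((hle _ _ h).trans ha) hb⟩
    · exact Or.inr ⟨m, hm, dvd_add ha ((hle _ _ h).trans hb)⟩
  | smul c a _ ha =>
    rcases ha with rfl | ⟨m, hm, ha⟩
    · simp
    · exact Or.inr ⟨m, hm, by simpa using ha.mul_left c⟩

variable [IsDomain V]

theorem mem_of_mem_radical_span (hx0 : ∀ l, x l ≠ 0) (hxu : ∀ l, ¬ IsUnit (x l))
    (hdvd : ∀ m l, m < l → ∀ n : ℕ, x l ^ n ∣ x m) {S : Set L} (hS : IsLowerSet S) {l : L}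
    (h : x l ∈ (Ideal.span (x '' S)).radical) : l ∈ S := by
  obtain ⟨n, hn⟩ := h
  rcases exists_dvd_of_mem_span hdvd hn with h0 | ⟨m, hm, hd⟩
  · exact absurd h0 (pow_ne_zero _ (hx0 l))
  by_contra hl
  have hml : m < l := lt_of_not_ge fun h => hl (hS h hm)
  have := (hdvd m l hml (n + 1)).trans hd
  have h1 : n + 1 ≤ n := (pow_dvd_pow_iff (hx0 l) (hxu l)).1 this
  omega

theorem exists_isPrimeIdealChain [ValuationRing V] (hx0 : ∀ l, x l ≠ 0) (hxu : ∀ l, ¬ IsUnit (x l))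
    (hdvd : ∀ m l, m < l → ∀ n : ℕ, x l ^ n ∣ x m) {ι : Type u} [LinearOrder ι]
    (S : ι → Set L) (hS : ∀ i, IsLowerSet (S i)) (hmono : StrictMono S) :
    ∃ C : Set (Ideal V), IsPrimeIdealChain C ∧ #C = #ι := by
  let P : ι → Ideal V := fun i => (Ideal.span (x '' S i)).radical
  have hP : Monotone P := fun i j hij =>
    Ideal.radical_mono (Ideal.span_mono (Set.image_mono (hmono.monotone hij)))
  have hsub : ∀ i j, P i = P j → S i ⊆ S j := fun i j h l hl =>
    mem_of_mem_radical_span hx0 hxu hdvd (hS j)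
      (h.le (Ideal.le_radical (Ideal.subset_span ⟨l, hl, rfl⟩)))
  have hinj : Function.Injective P := fun i j h =>
    hmono.injective ((hsub i j h).antisymm (hsub j i h.symm))
  refine ⟨Set.range P, ⟨?_, hP.isChain_range⟩, mk_range_eq P hinj⟩
  rintro _ ⟨i, rfl⟩
  refine isPrime_radical fun h => ?_
  rcases exists_dvd_of_mem_span hdvd ((Ideal.eq_top_iff_one _).1 h) with h | ⟨m, -, h⟩
  · exact one_ne_zero h
  · exact hxu m (isUnit_of_dvd_one h)

/-- Realised inside a Hahn series field with exponents in `Lex (L →₀ ℤ)`. -/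
theorem exists_infinitely_divisible_family (L : Type u) [LinearOrder L] [Infinite L] :
    ∃ (V : Type u) (_ : CommRing V) (_ : IsDomain V) (_ : ValuationRing V) (x : L → V),
      #V = #L ∧ (∀ l, x l ≠ 0) ∧ (∀ l, ¬ IsUnit (x l)) ∧
        ∀ m l, m < l → ∀ n : ℕ, x l ^ n ∣ x m := by
  let Γ := Lex (L →₀ ℤ)
  let H := HahnSeries Γ ℚ
  let t : L → Γ := fun l => toLex (Finsupp.single l 1)
  let X : L → H := fun l => HahnSeries.single (t l) 1
  let K : Subfield H := Subfield.closure (Set.range X)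
  let v : Valuation H (Multiplicative (WithTop Γ)ᵒᵈ) := HahnSeries.addVal Γ ℚ
  let A : ValuationSubring K := (v.comap K.subtype).valuationSubring
  have hA : ∀ y : K, y ∈ A ↔ 0 ≤ (y : H).orderTop := fun y => Iff.rfl
  have htlt : ∀ m l, m < l → ∀ n : ℕ, n • t l < t m := fun m l h n => by
    refine ⟨m, fun d hd => ?_, ?_⟩
    · change (n • Finsupp.single l (1 : ℤ)) d = Finsupp.single m 1 d
      simp [Finsupp.single_eq_of_ne hd.ne, Finsupp.single_eq_of_ne (hd.trans h).ne]
    · change (n • Finsupp.single l (1 : ℤ)) m < Finsupp.single m 1 m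
      simp [Finsupp.single_eq_of_ne h.ne]
  have htpos : ∀ l, 0 < t l := fun l => by
    refine ⟨l, fun d hd => ?_, ?_⟩
    · simp [t, Finsupp.single_eq_of_ne hd.ne]
    · simp [t]
  have htinj : Function.Injective t := fun a b h =>
    Finsupp.single_left_injective one_ne_zero (toLex.injective h)
  have hXord : ∀ l, (X l).orderTop = t l := fun l => HahnSeries.orderTop_single one_ne_zero
  have hXinj : Function.Injective X := fun a b h => htinj <| by
    have := congrArg HahnSeries.orderTop h
    rwa [hXord, hXord, WithTop.coe_inj] at this
  have hX0 : ∀ l, X l ≠ 0 := fun l => HahnSeries.single_ne_zero one_ne_zero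
  let xK : L → K := fun l => ⟨X l, Subfield.subset_closure ⟨l, rfl⟩⟩
  let x : L → A := fun l => ⟨xK l, (hA _).2 (by
    change 0 ≤ (X l).orderTop
    rw [hXord]; exact_mod_cast (htpos l).le)⟩
  have hxinj : Function.Injective x := fun a b h =>
    hXinj (congrArg (fun y : A => ((y : K) : H)) h)
  have hx0 : ∀ l, x l ≠ 0 := fun l h => hX0 l (congrArg (fun y : A => ((y : K) : H)) h)
  refine ⟨A, inferInstance, inferInstance, inferInstance, x, ?_, hx0, ?_, ?_⟩
  · refine le_antisymm ?_ (mk_le_of_injective hxinj)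
    refine (mk_le_of_injective (Subtype.val_injective (p := (· ∈ A)))).trans ?_
    refine (Subfield.cardinalMk_closure_le_max _).trans ?_
    rw [mk_range_eq X hXinj]
    exact max_le le_rfl (aleph0_le_mk L)
  · intro l hu
    obtain ⟨y, hy⟩ := hu.exists_right_inv
    have hy' : X l * ((y : K) : H) = 1 := congrArg (fun y : A => ((y : K) : H)) hy
    have h1 : (X l).orderTop + ((y : K) : H).orderTop = 0 := by
      rw [← HahnSeries.orderTop_mul, hy', HahnSeries.orderTop_one]
    have h2 := (hA y).1 y.2
    have h3 : (0 : WithTop Γ) < (X l).orderTop := by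
      rw [hXord]; exact_mod_cast htpos l
    exact absurd h1 (add_pos_of_pos_of_nonneg h3 h2).ne'
  · intro m l h n
    have hpow : xK l ^ n ≠ 0 := pow_ne_zero _ fun h => hX0 l (congrArg Subtype.val h)
    have hmul : xK m = xK l ^ n * (xK m / xK l ^ n) := (mul_div_cancel₀ _ hpow).symm
    have hmem : xK m / xK l ^ n ∈ A := by
      rw [hA]
      have h1 := congrArg (fun y : K => (y : H).orderTop) hmul
      have h2 : (X l ^ n).orderTop = ((n • t l : Γ) : WithTop Γ) := by
        rw [show X l ^ n = HahnSeries.single (n • t l) (1 ^ n) from HahnSeries.single_pow ..,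
          one_pow, HahnSeries.orderTop_single one_ne_zero]
      change (X m).orderTop = (X l ^ n * ((xK m / xK l ^ n : K) : H)).orderTop at h1
      rw [HahnSeries.orderTop_mul, h2, hXord] at h1
      by_contra! hneg
      have h4 : ((n • t l : Γ) : WithTop Γ) ≤ t m := by exact_mod_cast (htlt m l h n).le
      rw [h1] at h4
      generalize ((xK m / xK l ^ n : K) : H).orderTop = z at h4 hneg
      induction z with
      | top => exact absurd hneg (by simp)
      | coe z =>
        norm_cast at h4 hneg
        exact hneg (by simpa using h4)
    exact ⟨⟨_, hmem⟩, Subtype.ext hmul⟩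

end ValuationRing

section BinarySequences

variable (I : Type u) [LinearOrder I]

/-- Binary sequences on `I` vanishing beyond some index. -/
def boundedBinary : Set (Lex (I → Bool)) :=
  {f | ∃ a, ∀ b, a < b → f b = false}

theorem mk_le_boundedBinary : #I ≤ #(boundedBinary I) := by
  classical
  refine mk_le_of_injective (f := fun a => ⟨toLex fun b => decide (b = a), a, fun b hb => ?_⟩) ?_
  · simpa using hb.ne'
  · intro a b h
    have := congrFun (congrArg (fun f => ofLex f.1) h) a
    simpa using this

theorem mk_boundedBinary_le {κ : Cardinal.{u}} (hκ : ℵ₀ ≤ κ) (hI : #I ≤ κ)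
    (h : ∀ a : I, 2 ^ #(Set.Iic a) ≤ κ) : #(boundedBinary I) ≤ κ := by
  have hsub : boundedBinary I =
      ⋃ a : I, {f : Lex (I → Bool) | ∀ b, a < b → f b = false} := by
    ext f; simp [boundedBinary]
  rw [hsub]
  refine (mk_iUnion_le_sum_mk).trans ?_
  refine (sum_le_sum _ (fun _ => κ) fun a => ?_).trans ?_
  · refine le_trans ?_ (h a)
    have : (2 : Cardinal.{u}) ^ #(Set.Iic a) = #(Set.Iic a → Bool) := by simp
    rw [this]
    refine mk_le_of_injective (f := fun f b => f.1 b.1) ?_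
    rintro ⟨f, hf⟩ ⟨g, hg⟩ hfg
    refine Subtype.ext (funext fun b => ?_)
    rcases le_or_gt b a with hb | hb
    · exact congrFun hfg ⟨b, hb⟩
    · exact (hf b hb).trans (hg b hb).symm
  · rw [sum_const']
    exact (mul_le_mul_left hI κ).trans (mul_eq_self hκ).le

variable [WellFoundedLT I]

theorem exists_boundedBinary_between {f g : Lex (I → Bool)} (h : f < g) :
    ∃ l ∈ boundedBinary I, f < l ∧ l ≤ g := by
  classical
  obtain ⟨a, hlt, ha⟩ := h
  refine ⟨toLex fun b => if b ≤ a then g b else false, ⟨a, fun b hb => if_neg hb.not_ge⟩,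
    ⟨a, fun b hb => ?_, ?_⟩, Pi.toLex_monotone fun b => ?_⟩
  · exact (hlt b hb).trans (if_pos (le_of_lt hb)).symm
  · exact ha.trans_eq (if_pos le_rfl).symm
  · change (if b ≤ a then g b else false) ≤ g b
    split_ifs
    · exact le_rfl
    · exact Bool.false_le _

theorem strictMono_boundedBinary_cut :
    StrictMono fun f => ((↑) : boundedBinary I → Lex (I → Bool)) ⁻¹' Set.Iic f := by
  intro f g h
  obtain ⟨l, hl, hfl, hlg⟩ := exists_boundedBinary_between I h
  refine ⟨Set.preimage_mono (Set.Iic_subset_Iic.2 h.le), fun hsub => ?_⟩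
  exact hfl.not_ge (hsub (show (⟨l, hl⟩ : boundedBinary I) ∈ _ from hlg))

end BinarySequences

theorem two_power_le_of_lt_of_gch (hGCH : ∀ μ : Cardinal.{u}, ℵ₀ ≤ μ → 2 ^ μ = Order.succ μ)
    {κ μ : Cardinal.{u}} (hκ : ℵ₀ ≤ κ) (h : μ < κ) : 2 ^ μ ≤ κ := by
  rcases lt_or_ge μ ℵ₀ with hμ | hμ
  · exact (power_lt_aleph0 (natCast_lt_aleph0 (n := 2)) hμ).le.trans hκ
  · rw [hGCH μ hμ]; exact Order.succ_le_of_lt h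

/-- Assuming GCH (`2 ^ μ = μ⁺` for every infinite cardinal `μ`), for every
infinite cardinal `κ` there is a valuation ring of cardinality `κ` having a chain of prime
ideals of cardinality `2 ^ κ`. -/
theorem stmt5 (hGCH : ∀ μ : Cardinal.{u}, ℵ₀ ≤ μ → 2 ^ μ = Order.succ μ)
    (κ : Cardinal.{u}) (hκ : ℵ₀ ≤ κ) :
    ∃ (V : Type u) (_ : CommRing V) (_ : IsDomain V) (_ : ValuationRing V),
      #V = κ ∧ ∃ C : Set (Ideal V), IsPrimeIdealChain C ∧ #C = 2 ^ κ := by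
  let I := κ.ord.ToType
  have hI : #I = κ := mk_ord_toType κ
  have hL : #(boundedBinary I) = κ := by
    refine le_antisymm (mk_boundedBinary_le I hκ hI.le fun a => ?_)
      (hI.symm.le.trans (mk_le_boundedBinary I))
    refine two_power_le_of_lt_of_gch hGCH hκ ((mk_Iic_lt a ?_ ?_).trans_eq hI)
    · simp [I]
    · rwa [hI]
  have : Infinite (boundedBinary I) := infinite_iff.2 (hL.symm ▸ hκ)
  obtain ⟨V, i₁, i₂, i₃, x, hV, hx0, hxu, hdvd⟩ :=
    ValuationRing.exists_infinitely_divisible_family (boundedBinary I)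
  obtain ⟨C, hC, hcard⟩ := ValuationRing.exists_isPrimeIdealChain hx0 hxu hdvd _
    (fun f => (isLowerSet_Iic f).preimage (Subtype.mono_coe _))
    (strictMono_boundedBinary_cut I)
  refine ⟨V, i₁, i₂, i₃, hV.trans hL, C, hC, hcard.trans ?_⟩
  change #(I → Bool) = _
  rw [← hI]
  simp
end

section
/- For every infinite cardinal κ there exists a set X of cardinality κ and a family C of subsets of X that is totally ordered by inclusion and has cardinality κ⁺. -/
universe u
open Cardinal

section LexCuts

variable {W : Type u} [LinearOrder W] [WellFoundedLT W]

/-- A node `⟨i, h⟩` of the binary tree on `W`, extended to the full branch which is `h` below `i`,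
`true` at `i`, and `false` above `i`. -/
def extendNode (d : Σ i : W, (Set.Iio i → Bool)) : Lex (W → Bool) :=
  toLex fun j => if h : j < d.1 then d.2 ⟨j, h⟩ else decide (j = d.1)

/-- The nodes whose extension is lexicographically at most `f`. -/
def lexCut (f : Lex (W → Bool)) : Set (Σ i : W, (Set.Iio i → Bool)) :=
  {d | extendNode d ≤ f}

theorem exists_extendNode_mem_Ioc {f g : Lex (W → Bool)} (hfg : f < g) :
    ∃ d, f < extendNode d ∧ extendNode d ≤ g := by
  obtain ⟨i, hlt, hi⟩ := hfg
  obtain ⟨hf, hg⟩ : f i = false ∧ g i = true := Bool.lt_iff.1 hi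
  refine ⟨⟨i, fun j => g j⟩, ⟨i, fun j hj => ?_, ?_⟩, Pi.toLex_monotone fun j => ?_⟩
  · have hj' : j < i := hj
    simpa [extendNode, hj'] using hlt j hj
  · simp [extendNode, hf]
  · change (if h : j < i then g j else decide (j = i)) ≤ g j
    split_ifs with h
    · exact le_rfl
    · by_cases hji : j = i
      · subst hji
        simp [hg]
      · simp [hji]

theorem lexCut_strictMono : StrictMono (lexCut (W := W)) := fun f g hfg => by
  obtain ⟨d, hfd, hdg⟩ := exists_extendNode_mem_Ioc hfg
  exact ⟨fun e he => le_trans he hfg.le, fun h => (h hdg).not_gt hfd⟩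

end LexCuts

theorem mk_sigma_Iio_le {κ μ : Cardinal.{u}} (hκ : ℵ₀ ≤ κ) (hμ : μ ≤ κ)
    (h : ∀ ν < μ, 2 ^ ν ≤ κ) : #(Σ i : μ.ord.ToType, (Set.Iio i → Bool)) ≤ κ := by
  rw [mk_sigma]
  calc Cardinal.sum (fun i : μ.ord.ToType => #(Set.Iio i → Bool))
      ≤ Cardinal.sum (fun _ : μ.ord.ToType => κ) := by
        refine Cardinal.sum_le_sum _ _ fun i => ?_
        simpa using h _ (by simpa using mk_Iio_lt i (by simp))
    _ = μ * κ := by simp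
    _ ≤ κ := mul_le_of_le hκ hμ le_rfl

/-- For every infinite cardinal `κ` there is a set `X` of cardinality `κ` and
a family of subsets of `X`, totally ordered by inclusion, of cardinality `κ⁺`. -/
theorem stmt6 (κ : Cardinal.{u}) (hκ : ℵ₀ ≤ κ) :
    ∃ (X : Type u) (C : Set (Set X)),
      #X = κ ∧ IsChain (· ⊆ ·) C ∧ #C = Order.succ κ := by
  obtain ⟨μ, hμ, hmin⟩ := WellFounded.has_min (r := ((· < ·) : Cardinal.{u} → _ → Prop))
    wellFounded_lt {ν | κ < 2 ^ ν} ⟨κ, cantor κ⟩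
  have hμκ : μ ≤ κ := not_lt.1 (hmin κ (cantor κ))
  have hcard := mk_sigma_Iio_le hκ hμκ fun ν hν => not_lt.1 fun h => hmin ν h hν
  rw [← mk_out κ] at hcard
  obtain ⟨e⟩ := hcard
  let F : Lex (μ.ord.ToType → Bool) → Set κ.out := fun f => e '' lexCut f
  have hF : StrictMono F := e.injective.image_strictMono.comp lexCut_strictMono
  have hrange : Order.succ κ ≤ #(Set.range F) := by
    rw [mk_range_eq F hF.injective, Order.succ_le_iff]
    change κ < #(μ.ord.ToType → Bool)
    simpa using hμ
  obtain ⟨C, hC, hCcard⟩ := le_mk_iff_exists_subset.1 hrange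
  exact ⟨κ.out, C, mk_out κ, hF.monotone.isChain_range.mono hC, hCcard⟩
end

section
/- Let κ be a pseudo strong limit (PSL) cardinal, i.e., an infinite cardinal such that 2^α ≤ κ for every cardinal α < κ. Then there exists a set X of cardinality κ and a family C of subsets of X that is totally ordered by inclusion and has cardinality 2^κ. -/
universe u
open Cardinal

/-- The Boolean sequences indexed by `I`, ordered lexicographically, that are eventually false. -/
def eventuallyFalse (I : Type u) [LinearOrder I] : Set (Lex (I → Bool)) :=
  {g | ∃ i, ∀ j, i ≤ j → g j = false}

theorem exists_eventuallyFalse_between {I : Type u} [LinearOrder I] [WellFoundedLT I]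
    [NoMaxOrder I] {f f' : Lex (I → Bool)} (h : f < f') :
    ∃ g ∈ eventuallyFalse I, f < g ∧ g ≤ f' := by
  obtain ⟨i, hi, hlt⟩ := h
  obtain ⟨k, hk⟩ := exists_gt i
  refine ⟨toLex fun j => if j ≤ i then f' j else false, ⟨k, fun j hj => ?_⟩, ⟨i, ?_, ?_⟩, ?_⟩
  · exact if_neg (hk.trans_le hj).not_ge
  · intro j hj
    exact (hi j hj).trans (if_pos hj.le).symm
  · exact hlt.trans_eq (if_pos le_rfl).symm
  · refine Pi.toLex_monotone (b := ofLex f') fun j => ?_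
    by_cases hj : j ≤ i
    · exact (if_pos hj).le
    · exact (if_neg hj).trans_le (Bool.false_le _)

theorem mk_eventuallyFalse_le {κ : Cardinal.{u}} (hκ : ℵ₀ ≤ κ)
    (hpsl : ∀ α : Cardinal.{u}, α < κ → 2 ^ α ≤ κ) {I : Type u} [LinearOrder I]
    (hI : #I ≤ κ) (hlt : ∀ i : I, #(Set.Iio i) < κ) : #(eventuallyFalse I) ≤ κ := by
  have hpiece (i : I) : #{g : Lex (I → Bool) | ∀ j, i ≤ j → g j = false} ≤ κ := by
    refine le_trans ?_ (hpsl _ (hlt i))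
    have hpow : #(Set.Iio i → Bool) = 2 ^ #(Set.Iio i) := by simp
    refine le_trans ?_ hpow.le
    refine mk_le_of_injective (f := fun g (j : Set.Iio i) => g.1 j.1) fun g g' h => ?_
    refine Subtype.ext (funext fun j => ?_)
    by_cases hj : i ≤ j
    · exact (g.2 j hj).trans (g'.2 j hj).symm
    · exact congrFun h ⟨j, not_le.1 hj⟩
  have hunion : eventuallyFalse I = ⋃ i, {g : Lex (I → Bool) | ∀ j, i ≤ j → g j = false} := by
    ext g
    simp [eventuallyFalse]
  rw [hunion]
  calc
    _ ≤ _ := mk_iUnion_le _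
    _ ≤ κ * κ := mul_le_mul' hI (ciSup_le' hpiece)
    _ = κ := mul_eq_self hκ

theorem mk_le_mk_eventuallyFalse (I : Type u) [LinearOrder I] [NoMaxOrder I] :
    #I ≤ #(eventuallyFalse I) := by
  refine mk_le_of_injective (f := fun i => ⟨toLex fun j => decide (j = i), ?_⟩) fun i i' h => ?_
  · obtain ⟨k, hk⟩ := exists_gt i
    exact ⟨k, fun j hj => decide_eq_false (hk.trans_le hj).ne'⟩
  · have h' := congrFun (congrArg Subtype.val h) i
    exact of_decide_eq_true (h'.symm.trans (decide_eq_true rfl))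

/-- For every pseudo strong limit cardinal `κ` (infinite with `2 ^ α ≤ κ` for
all `α < κ`) there is a set `X` of cardinality `κ` and a family of subsets of `X`, totally
ordered by inclusion, of cardinality `2 ^ κ`. -/
theorem stmt7 (κ : Cardinal.{u}) (hκ : ℵ₀ ≤ κ)
    (hpsl : ∀ α : Cardinal.{u}, α < κ → 2 ^ α ≤ κ) :
    ∃ (X : Type u) (C : Set (Set X)),
      #X = κ ∧ IsChain (· ⊆ ·) C ∧ #C = 2 ^ κ := by
  let I := κ.ord.ToType
  have hI : #I = κ := mk_ord_toType κ
  have : NoMaxOrder I := noMaxOrder hκ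
  let below (f : Lex (I → Bool)) : Set (eventuallyFalse I) := {g | g.1 ≤ f}
  have hmono : Monotone below := fun f f' h g hg => le_trans hg h
  have hinj : Function.Injective below := by
    refine Function.Injective.of_lt_imp_ne fun f f' h heq => ?_
    obtain ⟨g, hg, hfg, hgf'⟩ := exists_eventuallyFalse_between h
    have hmem : (⟨g, hg⟩ : eventuallyFalse I) ∈ below f := heq ▸ hgf'
    exact hfg.not_ge hmem
  refine ⟨eventuallyFalse I, Set.range below, ?_, hmono.isChain_range, ?_⟩
  · have hIio (i : I) : #(Set.Iio i) < κ := (mk_Iio_lt i (by simp [I])).trans_eq hI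
    exact le_antisymm (mk_eventuallyFalse_le hκ hpsl hI.le hIio)
      (hI.symm.trans_le (mk_le_mk_eventuallyFalse I))
  · have hpow : #(I → Bool) = 2 ^ #I := by simp
    exact (mk_range_eq below hinj).trans (hpow.trans (by rw [hI]))
end

section
/- Let S be a set and let C be a chain of subsets of S. Define a binary relation ≺ on S by: x ≺ y if and only if there exists A ∈ C with x ∈ A and y ∉ A. Then: (1) ≺ is irreflexive and transitive (a strict partial order on S); and (2) there exists a subset S' ⊆ S such that the map C → 𝒫(S') sending A to A ∩ S' is injective, and the restriction of ≺ to S' is a strict total order (i.e., for distinct x, y ∈ S', either x ≺ y or y ≺ x). -/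
universe u

/-- Let `C` be a chain of subsets of `S` and let `≺` be the relation
`x ≺ y ↔ ∃ A ∈ C, x ∈ A ∧ y ∉ A`. Then `≺` is irreflexive and transitive, and there is a
subset `S' ⊆ S` such that `A ↦ A ∩ S'` is injective on `C` and `≺` restricted to `S'` is a
strict total order. -/
theorem stmt8 {S : Type u} (C : Set (Set S)) (hC : IsChain (· ⊆ ·) C)
    (prec : S → S → Prop) (hprec : ∀ x y, prec x y ↔ ∃ A ∈ C, x ∈ A ∧ y ∉ A) :
    (∀ x, ¬ prec x x) ∧
    (∀ x y z, prec x y → prec y z → prec x z) ∧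
    ∃ S' : Set S, Set.InjOn (fun A => A ∩ S') C ∧
      ∀ x ∈ S', ∀ y ∈ S', x ≠ y → prec x y ∨ prec y x := by
  refine ⟨fun x hx => ?_, fun x y z hxy hyz => ?_, ?_⟩
  · obtain ⟨A, -, h, h'⟩ := (hprec x x).1 hx
    exact h' h
  · obtain ⟨A, hA, hx, hy⟩ := (hprec x y).1 hxy
    obtain ⟨B, hB, hy', hz⟩ := (hprec y z).1 hyz
    refine (hprec x z).2 ⟨B, hB, ?_, hz⟩
    rcases hC.total hA hB with h | h
    · exact h hx
    · exact absurd (h hy') hy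
  · let r : Setoid S :=
      { r := fun x y => ∀ A ∈ C, x ∈ A ↔ y ∈ A
        iseqv := ⟨fun _ _ _ => Iff.rfl, fun h A hA => (h A hA).symm,
          fun h h' A hA => (h A hA).trans (h' A hA)⟩ }
    refine ⟨Set.range (Quotient.out : Quotient r → S), fun A hA B hB hAB => ?_, ?_⟩
    · ext x
      have hx : ∀ D ∈ C, (Quotient.mk r x).out ∈ D ↔ x ∈ D := Quotient.mk_out (s := r) x
      have hmem := Set.ext_iff.1 hAB (Quotient.mk r x).out
      simp only [Set.mem_inter_iff, Set.mem_range_self, and_true] at hmem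
      rw [← hx A hA, ← hx B hB, hmem]
    · rintro _ ⟨p, rfl⟩ _ ⟨q, rfl⟩ hne
      by_contra! h
      rw [hprec, hprec] at h
      have hpq : ∀ A ∈ C, p.out ∈ A ↔ q.out ∈ A := fun A hA =>
        ⟨fun hp => by_contra fun hq => h.1 ⟨A, hA, hp, hq⟩,
          fun hq => by_contra fun hp => h.2 ⟨A, hA, hq, hp⟩⟩
      exact hne (congrArg Quotient.out (Quotient.out_equiv_out.1 hpq))
end

section
/- Let κ and λ be cardinals with κ infinite and λ ≥ κ. Then the following are equivalent: (i) there exists a linearly ordered set B of cardinality λ with a dense subset D ⊆ B of cardinality κ; (ii) there exists a set T of cardinality κ and a chain C of subsets of T (totally ordered by inclusion) of cardinality λ. -/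
universe u
open Cardinal

/-- If every strict inequality `x < y` in `L` is weakly separated by some `d ∈ E`, then splitting
each point of `E` into a copy of `ℚ` produces a linear order in which the new points are dense. -/
theorem exists_dense_of_weakly_separating {κ lam : Cardinal.{u}} (hκ : ℵ₀ ≤ κ) (hle : κ ≤ lam)
    {L : Type u} [LinearOrder L] (E : Set L) (hL : #L = lam) (hE : #E ≤ κ)
    (h : ∀ x y : L, x < y → ∃ d ∈ E, x ≤ d ∧ d < y) :
    ∃ (B : Type u) (_ : LinearOrder B) (D : Set B), #B = lam ∧ #D = κ ∧
      ∀ x y : B, x < y → ∃ d ∈ D, x < d ∧ d < y := by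
  let S : Set (L ×ₗ ℚ) := {p | (ofLex p).1 ∈ E ∨ (ofLex p).2 = 0}
  let D₀ : Set S := {p | (ofLex p.1).1 ∈ E}
  have hS : #S = lam := by
    apply le_antisymm
    · calc #S ≤ #(L ×ₗ ℚ) := mk_set_le S
        _ = #(L × ℚ) := mk_congr ofLex
        _ = lam * ℵ₀ := by simp [hL]
        _ = lam := mul_aleph0_eq (hκ.trans hle)
    · rw [← hL]
      refine mk_le_of_injective (f := fun x => (⟨toLex (x, 0), Or.inr rfl⟩ : S)) ?_
      intro x y hxy
      simpa using hxy
  have hD₀ : #D₀ ≤ κ := by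
    calc #D₀ ≤ #(E × ℚ) := by
          refine mk_le_of_injective
            (f := fun p : D₀ => ((⟨(ofLex p.1.1).1, p.2⟩ : E), (ofLex p.1.1).2)) ?_
          intro p q hpq
          simp only [Prod.mk.injEq, Subtype.mk.injEq] at hpq
          exact Subtype.ext (Subtype.ext (ofLex.injective (Prod.ext hpq.1 hpq.2)))
      _ = #E * ℵ₀ := by simp
      _ ≤ κ * ℵ₀ := by gcongr
      _ = κ := mul_aleph0_eq hκ
  obtain ⟨P, hP⟩ := le_mk_iff_exists_set.1 (hle.trans_eq hS.symm)
  refine ⟨S, inferInstance, D₀ ∪ P, hS, ?_, ?_⟩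
  · apply le_antisymm
    · calc #(D₀ ∪ P : Set S) ≤ #D₀ + #P := mk_union_le _ _
        _ ≤ κ + κ := add_le_add hD₀ hP.le
        _ = κ := add_eq_self hκ
    · exact hP.ge.trans (mk_le_mk_of_subset Set.subset_union_right)
  · suffices hd : ∀ x y : S, x < y → ∃ d ∈ D₀, x < d ∧ d < y from fun x y hxy =>
      let ⟨d, hd, hlt⟩ := hd x y hxy
      ⟨d, Or.inl hd, hlt⟩
    rintro ⟨x, hx⟩ ⟨y, hy⟩ hxy
    have hxy' : x < y := hxy
    rcases Prod.Lex.lt_iff.1 hxy' with hlt | ⟨heq, hlt⟩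
    · obtain ⟨d, hdE, hxd, hdy⟩ := h _ _ hlt
      refine ⟨⟨toLex (d, (ofLex x).2 + 1), Or.inl hdE⟩, hdE, ?_, ?_⟩
      · change x < toLex (d, (ofLex x).2 + 1)
        rw [Prod.Lex.lt_iff]
        rcases hxd.lt_or_eq with hxd | hxd
        · exact Or.inl hxd
        · exact Or.inr ⟨hxd, lt_add_one _⟩
      · exact Prod.Lex.lt_iff.2 (Or.inl hdy)
    · have hxE : (ofLex x).1 ∈ E := by
        rcases hx with hx | hx
        · exact hx
        rcases hy with hy | hy
        · rwa [heq]
        · rw [hx, hy] at hlt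
          exact absurd hlt (lt_irrefl _)
      obtain ⟨q, hxq, hqy⟩ := exists_between hlt
      exact ⟨⟨toLex ((ofLex x).1, q), Or.inl hxE⟩, hxE,
        Prod.Lex.lt_iff.2 (Or.inr ⟨rfl, hxq⟩), Prod.Lex.lt_iff.2 (Or.inr ⟨heq, hqy⟩)⟩

/-- Unions of subfamilies of a chain of sets form a chain. -/
theorem IsChain.sUnion_subset_total {T : Type u} {C S S' : Set (Set T)}
    (hC : IsChain (· ⊆ ·) C) (hS : S ⊆ C) (hS' : S' ⊆ C) :
    ⋃₀ S ⊆ ⋃₀ S' ∨ ⋃₀ S' ⊆ ⋃₀ S := by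
  by_contra! hcon
  obtain ⟨x, ⟨s, hs, hxs⟩, hx⟩ := Set.not_subset.1 hcon.1
  refine hcon.2 (Set.sUnion_subset fun s' hs' => ?_)
  rcases hC.total (hS hs) (hS' hs') with hss | hss
  · exact absurd ⟨s', hs', hss hxs⟩ hx
  · exact hss.trans (Set.subset_sUnion_of_mem hs)

/-- A chain of cardinality `lam` of subsets of a set of cardinality `κ` yields a linear order of
cardinality `lam` with a dense subset of cardinality `κ`. -/
theorem exists_dense_of_isChain {κ lam : Cardinal.{u}} (hκ : ℵ₀ ≤ κ) (hle : κ ≤ lam)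
    {T : Type u} {C : Set (Set T)} (hT : #T = κ) (hC : IsChain (· ⊆ ·) C) (hCard : #C = lam) :
    ∃ (B : Type u) (_ : LinearOrder B) (D : Set B), #B = lam ∧ #D = κ ∧
      ∀ x y : B, x < y → ∃ d ∈ D, x < d ∧ d < y := by
  let cut : T → Set T := fun t => ⋃₀ {c ∈ C | t ∉ c}
  let C' : Set (Set T) := C ∪ Set.range cut
  have hrep : ∀ x ∈ C', ∃ S ⊆ C, x = ⋃₀ S := by
    rintro x (hx | ⟨t, rfl⟩)
    · exact ⟨{x}, by simpa using hx, by simp⟩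
    · exact ⟨_, Set.sep_subset _ _, rfl⟩
  have htotal : ∀ x ∈ C', ∀ y ∈ C', x ⊆ y ∨ y ⊆ x := by
    intro x hx y hy
    obtain ⟨S, hS, rfl⟩ := hrep x hx
    obtain ⟨S', hS', rfl⟩ := hrep y hy
    exact hC.sUnion_subset_total hS hS'
  let _ : LinearOrder C' :=
    { (inferInstance : PartialOrder C') with
      le_total := fun x y => htotal x x.2 y y.2
      toDecidableLE := Classical.decRel _ }
  have hC' : #C' = lam := by
    apply le_antisymm
    · calc #C' ≤ #C + #(Set.range cut) := mk_union_le _ _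
        _ ≤ lam + lam := add_le_add hCard.le (mk_range_le.trans (hT.trans_le hle))
        _ = lam := add_eq_self (hκ.trans hle)
    · exact hCard.ge.trans (mk_le_mk_of_subset Set.subset_union_left)
  let E : Set C' := Set.range fun t => ⟨cut t, Or.inr ⟨t, rfl⟩⟩
  refine exists_dense_of_weakly_separating hκ hle E hC' (mk_range_le.trans hT.le) ?_
  rintro ⟨x, hx⟩ ⟨y, hy⟩ hxy
  obtain ⟨t, hty, htx⟩ : ∃ t ∈ y, t ∉ x := Set.not_subset.1 hxy.not_ge
  have htcut : t ∉ cut t := by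
    rintro ⟨c, hc, htc⟩
    exact hc.2 htc
  refine ⟨_, ⟨t, rfl⟩, ?_, lt_of_not_ge fun hge => htcut (hge hty)⟩
  change x ⊆ cut t
  obtain ⟨S, hS, rfl⟩ := hrep x hx
  exact Set.sUnion_subset_sUnion fun s hs => ⟨hS hs, fun hts => htx ⟨s, hs, hts⟩⟩

/-- For cardinals `κ` infinite and `λ ≥ κ`: there is a linear order `B` of
cardinality `λ` with a dense subset `D` of cardinality `κ` iff there is a set `T` of
cardinality `κ` with a chain of subsets of `T` of cardinality `λ`. -/
theorem stmt9 (κ lam : Cardinal.{u}) (hκ : ℵ₀ ≤ κ) (hle : κ ≤ lam) :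
    (∃ (B : Type u) (_ : LinearOrder B) (D : Set B), #B = lam ∧ #D = κ ∧
        ∀ x y : B, x < y → ∃ d ∈ D, x < d ∧ d < y) ↔
    (∃ (T : Type u) (C : Set (Set T)), #T = κ ∧ IsChain (· ⊆ ·) C ∧ #C = lam) := by
  constructor
  · rintro ⟨B, _, D, hB, hD, hdense⟩
    let below : B → Set D := fun b => {d | d.1 < b}
    have hmono : Monotone below := fun a b hab d hd => lt_of_lt_of_le hd hab
    have hinj : Function.Injective below := by
      refine Function.Injective.of_lt_imp_ne fun x y hxy heq => ?_
      obtain ⟨d, hd, hxd, hdy⟩ := hdense x y hxy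
      have hdx : (⟨d, hd⟩ : D) ∈ below x := heq ▸ hdy
      exact hxd.not_gt hdx
    exact ⟨D, Set.range below, hD, hmono.isChain_range, (mk_range_eq _ hinj).trans hB⟩
  · rintro ⟨T, C, hT, hC, hCard⟩
    exact exists_dense_of_isChain hκ hle hT hC hCard
end

section
/- Let R be an infinite ring of cardinality κ. Then the cardinal Krull dimension of R is at most ded(κ); that is, every chain of prime ideals of R has cardinality at most ded(κ), and the supremum of the lengths of chains of prime ideals of R is at most ded(κ). -/
universe u
open Cardinal

noncomputable def ded (κ : Cardinal.{u}) : Cardinal.{u} :=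
  sSup {lam : Cardinal.{u} | ∃ (B : Type u) (_ : LinearOrder B) (D : Set B),
    #B = lam ∧ #D = κ ∧ ∀ x y : B, x < y → ∃ d ∈ D, x < d ∧ d < y}

theorem bddAbove_dedSet (κ : Cardinal.{u}) :
    BddAbove {lam : Cardinal.{u} | ∃ (B : Type u) (_ : LinearOrder B) (D : Set B),
      #B = lam ∧ #D = κ ∧ ∀ x y : B, x < y → ∃ d ∈ D, x < d ∧ d < y} := by
  refine ⟨2 ^ κ, ?_⟩
  rintro _ ⟨B, _, D, rfl, rfl, h⟩
  rw [← mk_set]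
  refine mk_le_of_injective (f := fun x : B => {d : D | d.1 < x}) ?_
  intro x y hxy
  by_contra hne
  rcases lt_or_gt_of_ne hne with hlt | hlt
  · obtain ⟨d, hd, h1, h2⟩ := h _ _ hlt
    exact lt_asymm h1 (((Set.ext_iff.1 hxy) ⟨d, hd⟩).2 h2)
  · obtain ⟨d, hd, h1, h2⟩ := h _ _ hlt
    exact lt_asymm h1 (((Set.ext_iff.1 hxy) ⟨d, hd⟩).1 h2)

theorem exists_linearOrder_isLowerSet_of_isChain {X : Type u} {C : Set (Set X)}
    (hC : IsChain (· ≤ ·) C) :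
    ∃ _ : LinearOrder X, ∀ P ∈ C, IsLowerSet P := by
  classical
  let r : X → X → Prop := fun a b => a = b ∨ ∃ P ∈ C, a ∈ P ∧ b ∉ P
  have hr : IsPartialOrder X r :=
    { refl := fun a => Or.inl rfl
      trans := by
        rintro a b c (rfl | ⟨P, hP, ha, hb⟩) (rfl | ⟨Q, hQ, hb', hc⟩)
        · exact Or.inl rfl
        · exact Or.inr ⟨Q, hQ, hb', hc⟩
        · exact Or.inr ⟨P, hP, ha, hb⟩
        · rcases hC.total hP hQ with h | h
          · exact Or.inr ⟨Q, hQ, h ha, hc⟩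
          · exact absurd (h hb') hb
      antisymm := by
        rintro a b (rfl | ⟨P, hP, ha, hb⟩) (h | ⟨Q, hQ, hb', ha'⟩)
        · rfl
        · rfl
        · exact h.symm
        · rcases hC.total hP hQ with h | h
          · exact absurd (h ha) ha'
          · exact absurd (h hb') hb }
  obtain ⟨s, hs, hrs⟩ := extend_partialOrder r
  let L : LinearOrder X :=
    { le := s
      le_refl := hs.refl
      le_trans := hs.trans
      le_antisymm := hs.antisymm
      le_total := hs.total
      toDecidableLE := Classical.decRel _ }
  refine ⟨L, fun P hP b a hab hb => ?_⟩
  by_contra ha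
  have hba : s b a := hrs _ _ (Or.inr ⟨P, hP, hb, ha⟩)
  exact ha (hs.antisymm a b hab hba ▸ hb)

theorem mk_lowerSet_le_ded (X : Type u) [LinearOrder X] [Infinite X] :
    #(LowerSet X) ≤ ded #X := by
  classical
  let B := {p : LowerSet X ×ₗ WithTop ℚ //
    (ofLex p).2 = ⊤ ∨ (ofLex p).1 ∈ Set.range LowerSet.Iic}
  let D : Set B := {p | (ofLex p.1).2 ≠ ⊤}
  have hB : #(LowerSet X) ≤ #B :=
    mk_le_of_injective (f := fun P => (⟨toLex (P, ⊤), Or.inl rfl⟩ : B)) fun P Q h =>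
      congrArg (fun p : B => (ofLex p.1).1) h
  refine hB.trans (le_csSup (bddAbove_dedSet _) ⟨B, inferInstance, D, rfl, ?_, ?_⟩)
  · let e : X × ℚ → D := fun p =>
      ⟨⟨toLex (LowerSet.Iic p.1, (p.2 : WithTop ℚ)), Or.inr ⟨p.1, rfl⟩⟩, WithTop.coe_ne_top⟩
    have he : Function.Bijective e := by
      constructor
      · rintro ⟨x, r⟩ ⟨y, s⟩ h
        have h1 : LowerSet.Iic x = LowerSet.Iic y :=
          congrArg (fun p : D => (ofLex p.1.1).1) h
        have h2 : (r : WithTop ℚ) = s := congrArg (fun p : D => (ofLex p.1.1).2) h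
        rw [LowerSet.Iic_injective h1, WithTop.coe_injective h2]
      · rintro ⟨⟨⟨P, r⟩, hp⟩, hr⟩
        obtain ⟨x, hx⟩ := hp.resolve_left hr
        obtain ⟨s, hs⟩ := WithTop.ne_top_iff_exists.1 hr
        refine ⟨(x, s), Subtype.ext (Subtype.ext ?_)⟩
        exact congrArg toLex (Prod.ext hx hs)
    rw [← mk_congr (Equiv.ofBijective e he), mk_prod, mk_eq_aleph0 ℚ, lift_aleph0, lift_id',
      mul_aleph0_eq (aleph0_le_mk X)]
  · rintro ⟨p, hp⟩ ⟨q, hq⟩ hpq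
    replace hpq : p < q := hpq
    suffices ∃ d : LowerSet X ×ₗ WithTop ℚ, (ofLex d).1 ∈ Set.range LowerSet.Iic ∧
        (ofLex d).2 ≠ ⊤ ∧ p < d ∧ d < q by
      obtain ⟨d, h1, h2, h3, h4⟩ := this
      exact ⟨⟨d, Or.inr h1⟩, h2, h3, h4⟩
    rw [Prod.Lex.lt_iff] at hpq
    by_cases htop : (ofLex p).2 = ⊤
    · have hlt : (ofLex p).1 < (ofLex q).1 := by
        rcases hpq with h | ⟨-, h⟩
        · exact h
        · exact absurd h (htop ▸ not_top_lt)
      obtain ⟨x, hxq, hxp⟩ := Set.exists_of_ssubset (LowerSet.coe_ssubset_coe.2 hlt)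
      obtain ⟨r, hr⟩ := exists_lt (ofLex q).2
      refine ⟨toLex (LowerSet.Iic x, r), ⟨x, rfl⟩, (hr.trans_le le_top).ne, ?_, ?_⟩
      · refine Prod.Lex.lt_iff.2 (Or.inl (lt_of_not_ge fun h => hxp ?_))
        exact LowerSet.Iic_le.1 h
      · rw [Prod.Lex.lt_iff]
        rcases (LowerSet.Iic_le.2 hxq).lt_or_eq with h | h
        · exact Or.inl h
        · exact Or.inr ⟨h, hr⟩
    · have hx := hp.resolve_left htop
      rcases hpq with h | ⟨h, h'⟩
      · obtain ⟨r, hr, hr'⟩ := exists_between (lt_top_iff_ne_top.2 htop)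
        exact ⟨toLex ((ofLex p).1, r), hx, hr'.ne, Prod.Lex.lt_iff.2 (Or.inr ⟨rfl, hr⟩),
          Prod.Lex.lt_iff.2 (Or.inl h)⟩
      · obtain ⟨r, hr, hr'⟩ := exists_between h'
        exact ⟨toLex ((ofLex p).1, r), hx, (hr'.trans_le le_top).ne,
          Prod.Lex.lt_iff.2 (Or.inr ⟨rfl, hr⟩), Prod.Lex.lt_iff.2 (Or.inr ⟨h, hr'⟩)⟩

theorem mk_le_ded_of_isChain {X : Type u} [Infinite X] {C : Set (Set X)}
    (hC : IsChain (· ≤ ·) C) : #C ≤ ded #X := by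
  obtain ⟨_, h⟩ := exists_linearOrder_isLowerSet_of_isChain hC
  refine le_trans ?_ (mk_lowerSet_le_ded X)
  exact mk_le_of_injective (f := fun P : C => (⟨P.1, h P.1 P.2⟩ : LowerSet X)) fun P Q hPQ =>
    Subtype.ext (congrArg LowerSet.carrier hPQ)

/-- If `R` is an infinite ring of cardinality `κ`, then every chain of prime
ideals of `R` has cardinality at most `ded κ`, and the cardinal Krull dimension of `R` is
at most `ded κ`. -/
theorem stmt11 (R : Type u) [Ring R] [Infinite R] (κ : Cardinal.{u}) (hκ : #R = κ) :
    (∀ C : Set (Ideal R), IsPrimeIdealChain C → #C ≤ ded κ) ∧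
    cKrullDim R ≤ ded κ := by
  subst hκ
  have key : ∀ C : Set (Ideal R), IsPrimeIdealChain C → #C ≤ ded #R := by
    intro C hC
    rw [← mk_image_eq (s := C) (SetLike.coe_injective : Function.Injective
      (fun P : Ideal R => (P : Set R)))]
    refine mk_le_ded_of_isChain ?_
    rintro _ ⟨P, hP, rfl⟩ _ ⟨Q, hQ, rfl⟩ -
    exact hC.2.total hP hQ
  exact ⟨key, ciSup_le' fun C => (chainLen_le_mk C.1).trans (key C.1 C.2.2)⟩
end

section
/- Let R be an infinite commutative unital ring and let S be a commutative Noetherian ring that is an integral extension of R (i.e., R is a subring of S and every element of S is integral over R). Then |R| = |S|. -/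
universe u
open Cardinal

/-- A prime quotient of an integral extension of an infinite ring `R` has cardinality at
most `#R`. -/
theorem Cardinal.mk_quotient_le_of_isIntegral (R S : Type u) [CommRing R] [CommRing S]
    [Infinite R] [Algebra R S] [Algebra.IsIntegral R S] (P : Ideal S) [P.IsPrime] :
    #(S ⧸ P) ≤ #R := by
  have h := Algebra.IsAlgebraic.cardinalMk_le_max (R ⧸ P.under R) (S ⧸ P)
  exact h.trans (max_le (mk_le_of_surjective Ideal.Quotient.mk_surjective) (aleph0_le_mk R))

/-- The middle term of a short exact sequence has cardinality at most the product of the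
cardinalities of the outer terms. -/
theorem Cardinal.mk_le_mul_of_exact {A M N P : Type u} [Ring A] [AddCommGroup M]
    [AddCommGroup N] [AddCommGroup P] [Module A M] [Module A N] [Module A P]
    {i : M →ₗ[A] N} {p : N →ₗ[A] P} (hp : Function.Surjective p)
    (hip : Function.Exact i p) : #N ≤ #M * #P := by
  obtain ⟨s, hs⟩ := hp.hasRightInverse
  rw [mul_def]
  refine mk_le_of_surjective (f := fun x : M × P ↦ i x.1 + s x.2) fun n ↦ ?_
  obtain ⟨m, hm⟩ := (hip (n - s (p n))).1 (by rw [map_sub, hs, sub_self])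
  exact ⟨(m, p n), by simp [hm]⟩

/-- If `R` is an infinite commutative unital ring and `S` is a commutative
Noetherian ring that is an integral extension of `R` (i.e. `R` embeds in `S` via an
injective ring homomorphism over which every element of `S` is integral), then
`|R| = |S|`. -/
theorem stmt17 (R : Type u) (S : Type u) [CommRing R] [CommRing S] [Infinite R]
    [IsNoetherianRing S] (f : R →+* S) (hf : Function.Injective f)
    (hint : f.IsIntegral) : #R = #S := by
  refine (mk_le_of_injective hf).antisymm ?_
  let _ : Algebra R S := f.toAlgebra
  have : Algebra.IsIntegral R S := ⟨hint⟩
  refine IsNoetherianRing.induction_on_isQuotientEquivQuotientPrime S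
    (motive := fun N _ _ _ ↦ #N ≤ #R) (inferInstance : Module.Finite S S) ?_ ?_ ?_
  · intro N _ _ _ _
    exact (le_one_iff_subsingleton.2 ‹_›).trans (one_le_aleph0.trans (aleph0_le_mk R))
  · intro N _ _ _ p e
    exact (mk_congr e.toEquiv).trans_le (mk_quotient_le_of_isIntegral R S p.1)
  · intro N₁ _ _ _ N₂ _ _ _ N₃ _ _ _ i p _ hp hip h₁ h₃
    exact (mk_le_mul_of_exact hp hip).trans
      ((mul_le_mul' h₁ h₃).trans (mul_eq_self (aleph0_le_mk R)).le)
end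

section
/- Let (P, ≤) be a partially ordered set. On nonempty subsets of P define S₁ ≼ S₂ iff for every s₂ ∈ S₂ there exists s₁ ∈ S₁ with s₁ ≤ s₂, and S₁ ≈ S₂ iff S₁ ≼ S₂ and S₂ ≼ S₁ (an equivalence relation, with classes [S]). Let A(P) := P ∪ { x_[S] : S ⊆ P is downward directed with no least element }, and define p ≤_A q iff one of: (1) p, q ∈ P and p ≤ q; (2) p ∈ P, q = x_[S], and p ≤ s for all s ∈ S; (3) p = x_[S], q ∈ P, and s ≤ q for some s ∈ S; (4) p = x_[S], q = x_[T], and S ≼ T. If (P, ≤) is linearly ordered, then (A(P), ≤_A) is linearly ordered. -/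
universe u

/-- The preorder `≼` on subsets of a poset: `S₁ ≼ S₂` iff every element of `S₂` has a lower
bound in `S₁`. -/
def SPre {P : Type u} [PartialOrder P] (S₁ S₂ : Set P) : Prop :=
  ∀ s₂ ∈ S₂, ∃ s₁ ∈ S₁, s₁ ≤ s₂

/-- `S` is downward directed with no least element. -/
def DDNoLeast {P : Type u} [PartialOrder P] (S : Set P) : Prop :=
  (S.Nonempty ∧ ∀ p ∈ S, ∀ q ∈ S, ∃ r ∈ S, r ≤ p ∧ r ≤ q) ∧
    ¬ ∃ x ∈ S, ∀ y ∈ S, x ≤ y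

/-- The equivalence `≈` (i.e. `S ≼ T` and `T ≼ S`) on downward directed subsets of `P`
with no least element. -/
def ddRel (P : Type u) [PartialOrder P]
    (S T : {S : Set P // DDNoLeast S}) : Prop :=
  SPre S.1 T.1 ∧ SPre T.1 S.1

/-- `A(P)`: the disjoint union of `P` with the `≈`-equivalence classes `[S]` of downward
directed subsets `S ⊆ P` having no least element. -/
def AT (P : Type u) [PartialOrder P] : Type u :=
  P ⊕ Quot (ddRel P)

/-- The relation `≤_A` on `A(P)` from Definition `leqAdef`: case (1) for two elements of
`P`, cases (2)–(4) involving classes `[S]` (expressed via representatives; the conditions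
are independent of the chosen representative). -/
def leA {P : Type u} [PartialOrder P] : AT P → AT P → Prop
  | Sum.inl p, Sum.inl q => p ≤ q
  | Sum.inl p, Sum.inr c => ∃ S : {S : Set P // DDNoLeast S},
      Quot.mk (ddRel P) S = c ∧ ∀ s ∈ S.1, p ≤ s
  | Sum.inr c, Sum.inl q => ∃ S : {S : Set P // DDNoLeast S},
      Quot.mk (ddRel P) S = c ∧ ∃ s ∈ S.1, s ≤ q
  | Sum.inr c, Sum.inr d => ∃ S T : {S : Set P // DDNoLeast S},
      Quot.mk (ddRel P) S = c ∧ Quot.mk (ddRel P) T = d ∧ SPre S.1 T.1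

/-- In a linear order, any two sets are comparable for `≼`. -/
theorem SPre.total {P : Type u} [LinearOrder P] (S T : Set P) : SPre S T ∨ SPre T S := by
  by_cases h : SPre S T
  · exact Or.inl h
  · unfold SPre at h
    push Not at h
    obtain ⟨t, ht, hlt⟩ := h
    exact Or.inr fun s hs => ⟨t, ht, (hlt s hs).le⟩

/-- In a linear order, a point is a lower bound of a set or has an element of the set below it. -/
theorem forall_le_or_exists_le {P : Type u} [LinearOrder P] (p : P) (S : Set P) :
    (∀ s ∈ S, p ≤ s) ∨ ∃ s ∈ S, s ≤ p := by
  by_cases h : ∀ s ∈ S, p ≤ s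
  · exact Or.inl h
  · push Not at h
    obtain ⟨s, hs, hlt⟩ := h
    exact Or.inr ⟨s, hs, hlt.le⟩

/-- If `(P, ≤)` is linearly ordered then `(A(P), ≤_A)` is linearly ordered;
since it is already known to be a partial order, the content is totality of `≤_A`. -/
theorem stmt18 (P : Type u) [LinearOrder P] (a b : AT P) : leA a b ∨ leA b a := by
  rcases a with p | c <;> rcases b with q | d
  · exact le_total p q
  · obtain ⟨T, rfl⟩ := Quot.exists_rep d
    exact (forall_le_or_exists_le p T.1).imp (fun h => ⟨T, rfl, h⟩) (fun h => ⟨T, rfl, h⟩)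
  · obtain ⟨S, rfl⟩ := Quot.exists_rep c
    exact (forall_le_or_exists_le q S.1).symm.imp (fun h => ⟨S, rfl, h⟩) (fun h => ⟨S, rfl, h⟩)
  · obtain ⟨S, rfl⟩ := Quot.exists_rep c
    obtain ⟨T, rfl⟩ := Quot.exists_rep d
    exact (SPre.total S.1 T.1).imp (fun h => ⟨S, T, rfl, rfl, h⟩) (fun h => ⟨T, S, rfl, rfl, h⟩)
end
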